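/- arXiv:2307.05712 — 2 statements merged into one kernel-verified Lean document; each statement's English description precedes it below -/
import Mathlib

section
/- Let F ∈ ℤ[x,y] have total degree 4 with F(0,0) = 0, and suppose F is quadratically composed. Then for every positive integer C and every integer D, F(ℤ²) ≠ (Cℤ)_{≥D} = {Cn : n ∈ ℤ, Cn ≥ D}. -/
open MvPolynomial

/-- Evaluation of an integer polynomial in two variables at a real point. -/
noncomputable def evalReal (G : MvPolynomial (Fin 2) ℤ) (x y : ℝ) : ℝ :=
  MvPolynomial.aeval ![x, y] G

/-- An integral binary form (or polynomial) is positive semi-definite if it is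
nonnegative at every real point. -/
def PosSemidef2 (G : MvPolynomial (Fin 2) ℤ) : Prop :=
  ∀ x y : ℝ, 0 ≤ evalReal G x y

/-- Positive definite: positive at every nonzero real point. -/
def PosDef2 (G : MvPolynomial (Fin 2) ℤ) : Prop :=
  ∀ x y : ℝ, (x, y) ≠ (0, 0) → 0 < evalReal G x y

/-- A primitive integral polynomial: the gcd of its coefficients is a unit. -/
def IsPrimitiveInt (G : MvPolynomial (Fin 2) ℤ) : Prop :=
  ∀ d : ℤ, (∀ m, d ∣ MvPolynomial.coeff m G) → IsUnit d

/-- The image of an integral polynomial in `ℚ[x,y]`. -/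
noncomputable def toQ (G : MvPolynomial (Fin 2) ℤ) : MvPolynomial (Fin 2) ℚ :=
  MvPolynomial.map (Int.castRingHom ℚ) G

/-- `Ft4` is the polynomial `F̃₄ = F₄ / P₀`, where `P₀` is the positive definite integral
form of largest degree (possibly a positive constant) dividing `F₄` such that the quotient
is a primitive integral form. -/
def IsTildePart (F4 Ft4 : MvPolynomial (Fin 2) ℤ) : Prop :=
  ∃ (P0 : MvPolynomial (Fin 2) ℤ) (k : ℕ),
    P0.IsHomogeneous k ∧ PosDef2 P0 ∧ F4 = P0 * Ft4 ∧
    (∃ n, Ft4.IsHomogeneous n) ∧ IsPrimitiveInt Ft4 ∧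
    (∀ (P0' Ft4' : MvPolynomial (Fin 2) ℤ) (k' : ℕ),
      P0'.IsHomogeneous k' → PosDef2 P0' → F4 = P0' * Ft4' →
      (∃ n, Ft4'.IsHomogeneous n) → IsPrimitiveInt Ft4' → k' ≤ k)

/-- Two integral polynomials have a common non-constant factor over `ℚ`
(i.e. their gcd in `ℚ[x,y]` is not 1). -/
def CommonFactor2 (A B : MvPolynomial (Fin 2) ℤ) : Prop :=
  ∃ d : MvPolynomial (Fin 2) ℚ, 0 < d.totalDegree ∧ d ∣ toQ A ∧ d ∣ toQ B

/-- Three integral polynomials have a common non-constant factor over `ℚ`. -/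
def CommonFactor3 (A B C : MvPolynomial (Fin 2) ℤ) : Prop :=
  ∃ d : MvPolynomial (Fin 2) ℚ, 0 < d.totalDegree ∧ d ∣ toQ A ∧ d ∣ toQ B ∧ d ∣ toQ C

/-- Four integral polynomials have a common non-constant factor over `ℚ`. -/
def CommonFactor4 (A B C D : MvPolynomial (Fin 2) ℤ) : Prop :=
  ∃ d : MvPolynomial (Fin 2) ℚ, 0 < d.totalDegree ∧
    d ∣ toQ A ∧ d ∣ toQ B ∧ d ∣ toQ C ∧ d ∣ toQ D

/-- The value set `F(ℤ²)`. -/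
def valueSet (F : MvPolynomial (Fin 2) ℤ) : Set ℤ :=
  {m : ℤ | ∃ x y : ℤ, MvPolynomial.eval ![x, y] F = m}

/-- The set `(Cℤ)_{≥ D} = {Cn : n ∈ ℤ, Cn ≥ D}`. -/
def targetSet (C D : ℤ) : Set ℤ :=
  {m : ℤ | (∃ n : ℤ, m = C * n) ∧ D ≤ m}

/-- An integral binary form is indefinite if it takes both positive and negative
values on `ℝ²`. -/
def Indefinite2 (G : MvPolynomial (Fin 2) ℤ) : Prop :=
  (∃ x y : ℝ, 0 < evalReal G x y) ∧ (∃ x y : ℝ, evalReal G x y < 0)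

/-- `F` is quadratically composed:
`F = H^{2r} G₄ + H^r G₃ + F₂ + F₁` with `r ∈ {1,2}`, `F₄ = H^{2r} G₄` positive
semi-definite, `H` a primitive integral linear form or an indefinite irreducible
primitive integral quadratic form, `G₄`, `G₃` integral forms, and `H ∤ G₄, G₃, F₂`. -/
def QuadraticallyComposed (F : MvPolynomial (Fin 2) ℤ) : Prop :=
  ∃ (H G4 G3 : MvPolynomial (Fin 2) ℤ) (r : ℕ), (r = 1 ∨ r = 2) ∧
    MvPolynomial.homogeneousComponent 4 F = H ^ (2 * r) * G4 ∧
    MvPolynomial.homogeneousComponent 3 F = H ^ r * G3 ∧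
    F = MvPolynomial.homogeneousComponent 4 F + MvPolynomial.homogeneousComponent 3 F +
        MvPolynomial.homogeneousComponent 2 F + MvPolynomial.homogeneousComponent 1 F ∧
    PosSemidef2 (MvPolynomial.homogeneousComponent 4 F) ∧
    ((H.IsHomogeneous 1 ∧ IsPrimitiveInt H) ∨
      (H.IsHomogeneous 2 ∧ IsPrimitiveInt H ∧ Irreducible (toQ H) ∧ Indefinite2 H)) ∧
    (∃ n, G4.IsHomogeneous n) ∧ (∃ n, G3.IsHomogeneous n) ∧
    ¬ H ∣ G4 ∧ ¬ H ∣ G3 ∧ ¬ H ∣ MvPolynomial.homogeneousComponent 2 F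


def ThinV (V : Set ℤ) : Prop :=
  ∃ K : ℤ, ∀ n : ℤ, 1 ≤ n → ∃ S : Finset ℤ, (S.card : ℤ) ≤ K * n ^ 3 ∧
    ∀ v ∈ V, v ≤ n ^ 4 → v ∈ S

theorem ThinV.mono {V W : Set ℤ} (hW : ThinV W) (h : V ⊆ W) : ThinV V := by
  obtain ⟨K, hK⟩ := hW
  refine ⟨K, fun n hn => ?_⟩
  obtain ⟨S, h1, h2⟩ := hK n hn
  exact ⟨S, h1, fun v hv => h2 v (h hv)⟩

theorem ThinV.union {V W : Set ℤ} (hV : ThinV V) (hW : ThinV W) : ThinV (V ∪ W) := by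
  obtain ⟨K, hK⟩ := hV
  obtain ⟨L, hL⟩ := hW
  refine ⟨K + L, fun n hn => ?_⟩
  obtain ⟨S, h1, h2⟩ := hK n hn
  obtain ⟨T, h3, h4⟩ := hL n hn
  refine ⟨S ∪ T, ?_, ?_⟩
  · have : ((S ∪ T).card : ℤ) ≤ S.card + T.card := by exact_mod_cast Finset.card_union_le S T
    linarith
  · rintro v (hv | hv) hn
    · exact Finset.mem_union_left _ (h2 v hv hn)
    · exact Finset.mem_union_right _ (h4 v hv hn)

theorem ThinV.empty : ThinV ∅ := ⟨0, fun n _ => ⟨∅, by simp, by simp⟩⟩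

theorem ThinV.singleton (v : ℤ) : ThinV {v} :=
  ⟨1, fun n hn => ⟨{v}, by simp; exact one_le_pow₀ hn, by simp⟩⟩

theorem ThinV.biUnion {ι : Type*} (s : Finset ι) (V : ι → Set ℤ) (h : ∀ i ∈ s, ThinV (V i)) :
    ThinV {v | ∃ i ∈ s, v ∈ V i} := by
  classical
  induction s using Finset.induction_on with
  | empty => exact ThinV.empty.mono (by intro v; simp)
  | insert a s ha ih =>
    refine ((h a (by simp)).union (ih fun i hi => h i (by simp [hi]))).mono ?_
    rintro v ⟨i, hi, hv⟩
    rcases Finset.mem_insert.1 hi with rfl | hi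
    · exact Or.inl hv
    · exact Or.inr ⟨i, hi, hv⟩

theorem ThinV.ne_target {C D : ℤ} (hC : 0 < C) : ¬ ThinV (targetSet C D) := by
  rintro ⟨K, hK⟩
  set m : ℤ := |K| + |D| + 1 with hm
  have hK0 := abs_nonneg K
  have hD0 := abs_nonneg D
  have hm1 : 1 ≤ m := by omega
  obtain ⟨S, h1, h2⟩ := hK (C * m) (by nlinarith)
  have hinj : ((Finset.Icc |D| (C ^ 3 * m ^ 4)).image (fun j => C * j)) ⊆ S := by
    intro v hv
    obtain ⟨j, hj, rfl⟩ := Finset.mem_image.1 hv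
    rw [Finset.mem_Icc] at hj
    apply h2
    · refine ⟨⟨j, rfl⟩, ?_⟩
      have := le_abs_self D
      nlinarith
    · have := mul_le_mul_of_nonneg_left hj.2 hC.le
      linarith [mul_pow C m 4, (by ring : C * (C ^ 3 * m ^ 4) = (C * m) ^ 4)]
  have hc := Finset.card_le_card hinj
  rw [Finset.card_image_of_injective _ (mul_right_injective₀ hC.ne')] at hc
  rw [Int.card_Icc] at hc
  have h5 : C ^ 3 * m ^ 4 + 1 - |D| ≤ S.card := by omega
  have h6 : C ^ 3 * m ^ 4 + 1 - |D| ≤ K * (C * m) ^ 3 := h5.trans h1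
  have h7 : 1 ≤ C ^ 3 * m ^ 3 := by
    have : 0 < C ^ 3 * m ^ 3 := by positivity
    omega
  have h8 : |D| + 1 ≤ m - K := by have := le_abs_self K; omega
  have h9 : C ^ 3 * m ^ 3 * (m - K) + 1 - |D| ≤ 0 := by linarith [mul_pow C m 3, (by ring : C ^ 3 * m ^ 3 * (m - K) = C ^ 3 * m ^ 4 - K * (C * m) ^ 3)]
  nlinarith

/-- Values of a quadratic polynomial with positive leading coefficient are thin. -/
theorem ThinV.line {V : Set ℤ} (e α β γ : ℤ) (he : 0 < e) (hα : 0 < α)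
    (h : ∀ v ∈ V, ∃ w : ℤ, e * v = α * w ^ 2 + β * w + γ) : ThinV V := by
  set K : ℤ := e + |β| + |γ| + 1 with hKdef
  have hβ := abs_nonneg β
  have hγ := abs_nonneg γ
  refine ⟨2 * K + 1, fun n hn => ⟨(Finset.Icc (-(K * n ^ 2)) (K * n ^ 2)).image
    (fun w => (α * w ^ 2 + β * w + γ) / e), ?_, ?_⟩⟩
  · have h1 : (((Finset.Icc (-(K * n ^ 2)) (K * n ^ 2)).image
      (fun w => (α * w ^ 2 + β * w + γ) / e)).card : ℤ) ≤ (Finset.Icc (-(K * n ^ 2)) (K * n ^ 2)).card := by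
      exact_mod_cast Finset.card_image_le
    rw [Int.card_Icc] at h1
    have h2 : 0 ≤ K * n ^ 2 := by positivity
    have h3 : n ^ 2 ≤ n ^ 3 := pow_le_pow_right₀ hn (by norm_num)
    have h4 : 1 ≤ n ^ 3 := one_le_pow₀ hn
    rw [Int.toNat_of_nonneg (by omega)] at h1
    nlinarith
  · intro v hv hvn
    obtain ⟨w, hw⟩ := h v hv
    rw [Finset.mem_image]
    refine ⟨w, ?_, ?_⟩
    · rw [Finset.mem_Icc, ← abs_le]
      by_contra hcon
      push Not at hcon
      have h1 : α * w ^ 2 + β * w + γ ≤ e * n ^ 4 := by rw [← hw]; exact mul_le_mul_of_nonneg_left hvn he.le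
      have h2 : -(|β| * |w|) ≤ β * w := by rw [← abs_mul]; exact neg_abs_le _
      have h3 := neg_abs_le γ
      have hn2 : 1 ≤ n ^ 2 := one_le_pow₀ hn
      have h4 : w ^ 2 ≤ α * w ^ 2 := by nlinarith [sq_nonneg w]
      have h5 : w ^ 2 = |w| * |w| := by rw [← sq, sq_abs]
      have h6 : 1 ≤ |w| := by nlinarith
      have h8 : (e + |γ| + 1) * n ^ 2 ≤ |w| - |β| := by nlinarith
      have h9 : n ^ 2 ≤ |w| := by nlinarith
      have h10 : n ^ 2 * ((e + |γ| + 1) * n ^ 2) ≤ |w| * (|w| - |β|) :=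
        mul_le_mul h9 h8 (by positivity) (by positivity)
      have h11 : 1 ≤ n ^ 4 := one_le_pow₀ hn
      have h12 : |γ| ≤ |γ| * n ^ 4 := le_mul_of_one_le_right hγ h11
      linarith [(by ring : n ^ 2 * ((e + |γ| + 1) * n ^ 2) = e * n ^ 4 + |γ| * n ^ 4 + n ^ 4),
        (by ring : |w| * (|w| - |β|) = |w| * |w| - |β| * |w|)]
    · rw [← hw]; exact Int.mul_ediv_cancel_left _ he.ne'

theorem bb4 {a b c e D : ℤ} (h : ∀ x : ℤ, D ≤ a * x ^ 4 + b * x ^ 3 + c * x ^ 2 + e * x) :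
    0 ≤ a := by
  by_contra ha
  push Not at ha
  set n : ℤ := |b| + |c| + |e| + |D| + 1 with hn
  have := h n
  have hb := le_abs_self b
  have hc := le_abs_self c
  have he := le_abs_self e
  have hD := neg_abs_le D
  have := abs_nonneg b
  have := abs_nonneg c
  have := abs_nonneg e
  have := abs_nonneg D
  have hn1 : 1 ≤ n := by omega
  have h3 : n ^ 2 ≤ n ^ 3 := pow_le_pow_right₀ hn1 (by norm_num)
  have h4 : n ≤ n ^ 3 := le_self_pow₀ hn1 (by norm_num)
  have h5 : 1 ≤ n ^ 3 := one_le_pow₀ hn1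
  have e1 : a * n ^ 4 ≤ -1 * n ^ 4 := mul_le_mul_of_nonneg_right (by omega) (by positivity)
  have e2 : b * n ^ 3 ≤ |b| * n ^ 3 := mul_le_mul_of_nonneg_right hb (by positivity)
  have e3 : c * n ^ 2 ≤ |c| * n ^ 3 := mul_le_mul hc h3 (by positivity) (by positivity)
  have e4 : e * n ≤ |e| * n ^ 3 := mul_le_mul he h4 (by positivity) (by positivity)
  have e5 : n ^ 4 = n ^ 3 * (|b| + |c| + |e| + |D| + 1) := by rw [← hn]; ring
  have e6 : |D| ≤ |D| * n ^ 3 := le_mul_of_one_le_right (by positivity) h5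
  linarith

theorem bb3 {b c e D : ℤ} (h : ∀ x : ℤ, D ≤ b * x ^ 3 + c * x ^ 2 + e * x) : b = 0 := by
  have key : ∀ b c e : ℤ, (∀ x : ℤ, D ≤ b * x ^ 3 + c * x ^ 2 + e * x) → 0 ≤ b := by
    intro b c e h
    by_contra hb0
    push Not at hb0
    set n : ℤ := |c| + |e| + |D| + 1 with hn
    have := h n
    have hc := le_abs_self c
    have he := le_abs_self e
    have hD := neg_abs_le D
    have := abs_nonneg c
    have := abs_nonneg e
    have := abs_nonneg D
    have hn1 : 1 ≤ n := by omega
    have h4 : n ≤ n ^ 2 := le_self_pow₀ hn1 (by norm_num)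
    have h5 : 1 ≤ n ^ 2 := one_le_pow₀ hn1
    have e2 : b * n ^ 3 ≤ -1 * n ^ 3 := mul_le_mul_of_nonneg_right (by omega) (by positivity)
    have e3 : c * n ^ 2 ≤ |c| * n ^ 2 := mul_le_mul_of_nonneg_right hc (by positivity)
    have e4 : e * n ≤ |e| * n ^ 2 := mul_le_mul he h4 (by positivity) (by positivity)
    have e5 : n ^ 3 = n ^ 2 * (|c| + |e| + |D| + 1) := by rw [← hn]; ring
    have e6 : |D| ≤ |D| * n ^ 2 := le_mul_of_one_le_right (by positivity) h5
    linarith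
  have h1 := key b c e h
  have h2 := key (-b) c (-e) (fun x => by have := h (-x); nlinarith)
  omega

theorem bb2 {c e D : ℤ} (h : ∀ x : ℤ, D ≤ c * x ^ 2 + e * x) : 0 ≤ c := by
  by_contra hc0
  push Not at hc0
  set n : ℤ := |e| + |D| + 1 with hn
  have := h n
  have he := le_abs_self e
  have hD := neg_abs_le D
  have := abs_nonneg e
  have := abs_nonneg D
  have hn1 : 1 ≤ n := by omega
  have e3 : c * n ^ 2 ≤ -1 * n ^ 2 := mul_le_mul_of_nonneg_right (by omega) (by positivity)
  have e4 : e * n ≤ |e| * n := mul_le_mul_of_nonneg_right he (by positivity)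
  have e5 : n ^ 2 = n * (|e| + |D| + 1) := by rw [← hn]; ring
  have e6 : |D| ≤ |D| * n := le_mul_of_one_le_right (by positivity) hn1
  linarith

theorem bb1 {e D : ℤ} (h : ∀ x : ℤ, D ≤ e * x) : e = 0 := by
  have hD := neg_abs_le D
  have := abs_nonneg D
  have h1 := h (|D| + 1)
  have h2 := h (-(|D| + 1))
  rcases lt_trichotomy e 0 with h | h | h
  · nlinarith
  · exact h
  · nlinarith

/-- Quadratic polynomial bounded below on integers has thin value set. -/
theorem ThinV.quad (α β γ D : ℤ) (h : ∀ z : ℤ, D ≤ α * z ^ 2 + β * z + γ) :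
    ThinV {v | ∃ z : ℤ, v = α * z ^ 2 + β * z + γ} := by
  have h1 : 0 ≤ α := bb2 (D := D - γ) (e := β) fun x => by linarith [h x]
  rcases h1.lt_or_eq with h1 | h1
  · exact ThinV.line 1 α β γ one_pos h1 (by rintro v ⟨z, rfl⟩; exact ⟨z, by ring⟩)
  · subst h1
    have h2 : β = 0 := bb1 (D := D - γ) fun x => by linarith [h x]
    subst h2
    exact (ThinV.singleton γ).mono (by rintro v ⟨z, rfl⟩; simp)

theorem strip_finset (K n : ℤ) (hK : 0 ≤ K) (hn : 1 ≤ n) (θ : ℝ) :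
    ∃ S : Finset (ℤ × ℤ), (S.card : ℤ) ≤ (2 * K + 1) * (2 * K + 3) * n ^ 3 ∧
      ∀ x y : ℤ, |x| ≤ K * n ^ 2 → |(y : ℝ) - θ * x| ≤ K * n → (x, y) ∈ S := by
  refine ⟨((Finset.Icc (-(K * n ^ 2)) (K * n ^ 2)) ×ˢ (Finset.Icc (-(K * n + 1)) (K * n + 1))).image
    (fun p => (p.1, ⌊θ * p.1⌋ + p.2)), ?_, ?_⟩
  · have h1 := Finset.card_image_le (s := ((Finset.Icc (-(K * n ^ 2)) (K * n ^ 2)) ×ˢ (Finset.Icc (-(K * n + 1)) (K * n + 1)))) (f := (fun p : ℤ × ℤ => (p.1, ⌊θ * p.1⌋ + p.2)))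
    rw [Finset.card_product, Int.card_Icc, Int.card_Icc] at h1
    have h2 : 0 ≤ K * n ^ 2 := by positivity
    have h3 : 0 ≤ K * n := by positivity
    zify at h1
    rw [Int.toNat_of_nonneg (by omega), Int.toNat_of_nonneg (by omega)] at h1
    refine h1.trans ?_
    have hn2 : 1 ≤ n ^ 2 := one_le_pow₀ hn
    calc (K * n ^ 2 + 1 - -(K * n ^ 2)) * (K * n + 1 + 1 - -(K * n + 1))
        ≤ ((2 * K + 1) * n ^ 2) * ((2 * K + 3) * n) := by
          apply mul_le_mul <;> nlinarith
      _ = _ := by ring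
  · intro x y hx hy
    rw [Finset.mem_image]
    refine ⟨(x, y - ⌊θ * x⌋), ?_, by simp⟩
    rw [Finset.mem_product, Finset.mem_Icc, Finset.mem_Icc]
    refine ⟨abs_le.1 hx, ?_⟩
    rw [abs_le] at hy
    have h1 := Int.floor_le (θ * x)
    have h2 := Int.lt_floor_add_one (θ * x)
    constructor
    · have : (-(K * n + 1 : ℤ) : ℝ) ≤ ((y - ⌊θ * x⌋ : ℤ) : ℝ) := by push_cast; linarith
      exact_mod_cast this
    · have : ((y - ⌊θ * x⌋ : ℤ) : ℝ) ≤ ((K * n + 1 : ℤ) : ℝ) := by push_cast; linarith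
      exact_mod_cast this

theorem ThinV.region {V : Set ℤ} (f : ℤ → ℤ → ℤ) (K : ℤ) (hK : 0 ≤ K) (θ₁ θ₂ : ℝ)
    (h : ∀ n : ℤ, 1 ≤ n → ∀ v ∈ V, v ≤ n ^ 4 → ∃ x y : ℤ, f x y = v ∧
      ((|x| ≤ K * n ^ 2 ∧ |(y : ℝ) - θ₁ * x| ≤ K * n) ∨
       (|x| ≤ K * n ^ 2 ∧ |(y : ℝ) - θ₂ * x| ≤ K * n) ∨
       (|x| ≤ K * n ∧ |y| ≤ K * n ^ 2))) : ThinV V := by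
  classical
  refine ⟨3 * ((2 * K + 1) * (2 * K + 3)), fun n hn => ?_⟩
  obtain ⟨S1, c1, h1⟩ := strip_finset K n hK hn θ₁
  obtain ⟨S2, c2, h2⟩ := strip_finset K n hK hn θ₂
  obtain ⟨S3, c3, h3⟩ := strip_finset K n hK hn 0
  refine ⟨(S1.image fun p => f p.1 p.2) ∪ (S2.image fun p => f p.1 p.2) ∪
    (S3.image fun p => f p.2 p.1), ?_, ?_⟩
  · have e1 := Finset.card_union_le ((S1.image fun p => f p.1 p.2) ∪ (S2.image fun p => f p.1 p.2)) (S3.image fun p => f p.2 p.1)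
    have e2 := Finset.card_union_le (S1.image fun p => f p.1 p.2) (S2.image fun p => f p.1 p.2)
    have e3 := Finset.card_image_le (s := S1) (f := fun p => f p.1 p.2)
    have e4 := Finset.card_image_le (s := S2) (f := fun p => f p.1 p.2)
    have e5 := Finset.card_image_le (s := S3) (f := fun p => f p.2 p.1)
    zify at e1 e2 e3 e4 e5
    linarith
  · intro v hv hvn
    obtain ⟨x, y, rfl, hx | hx | hx⟩ := h n hn v hv hvn
    · exact Finset.mem_union_left _ (Finset.mem_union_left _
        (Finset.mem_image.2 ⟨(x, y), h1 x y hx.1 hx.2, rfl⟩))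
    · exact Finset.mem_union_left _ (Finset.mem_union_right _
        (Finset.mem_image.2 ⟨(x, y), h2 x y hx.1 hx.2, rfl⟩))
    · refine Finset.mem_union_right _ (Finset.mem_image.2 ⟨(y, x), h3 y x hx.2 ?_, rfl⟩)
      simp only [zero_mul, sub_zero]
      exact_mod_cast hx.1

theorem int_abs_le_sq (x : ℤ) : |x| ≤ x ^ 2 := by
  rw [abs_le]
  constructor
  · rcases le_or_gt x (-1) with h | h <;> nlinarith [sq_nonneg x]
  · rcases le_or_gt x 0 with h | h <;> nlinarith [sq_nonneg x]

theorem abs_quad_le (d e f x y : ℤ) :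
    |d * x ^ 2 + e * (x * y) + f * y ^ 2| ≤ (|d| + |e| + |f|) * (x ^ 2 + y ^ 2) := by
  have h1 : |d * x ^ 2 + e * (x * y) + f * y ^ 2| ≤ |d * x ^ 2| + |e * (x * y)| + |f * y ^ 2| :=
    abs_add_three _ _ _
  rw [abs_mul d, abs_mul e, abs_mul f, abs_of_nonneg (sq_nonneg x), abs_of_nonneg (sq_nonneg y)] at h1
  have h2 : |x * y| ≤ x ^ 2 + y ^ 2 := by
    rw [abs_le]; constructor <;> nlinarith [sq_nonneg (x + y), sq_nonneg (x - y)]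
  have h3 := mul_le_mul_of_nonneg_left h2 (abs_nonneg e)
  have h4 := mul_nonneg (abs_nonneg d) (sq_nonneg y)
  have h5 := mul_nonneg (abs_nonneg f) (sq_nonneg x)
  linarith

theorem abs_lin_le (l m x y : ℤ) :
    |l * x + m * y| ≤ (|l| + |m|) * (x ^ 2 + y ^ 2) := by
  have h1 : |l * x + m * y| ≤ |l * x| + |m * y| := abs_add_le _ _
  rw [abs_mul, abs_mul] at h1
  have h2 : |x| ≤ x ^ 2 := int_abs_le_sq x
  have h3 : |y| ≤ y ^ 2 := int_abs_le_sq y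
  have h4 : |l| * |x| ≤ |l| * (x ^ 2 + y ^ 2) :=
    mul_le_mul_of_nonneg_left (by nlinarith [sq_nonneg y]) (abs_nonneg l)
  have h5 : |m| * |y| ≤ |m| * (x ^ 2 + y ^ 2) :=
    mul_le_mul_of_nonneg_left (by nlinarith [sq_nonneg x]) (abs_nonneg m)
  linarith

theorem abs_le_of_sq_le' {z E M : ℤ} (hE : 1 ≤ E) (hM : 0 ≤ M) (h : z ^ 2 ≤ E * M ^ 2) :
    |z| ≤ E * M := by
  apply abs_le_of_sq_le_sq _ (by positivity)
  nlinarith [mul_nonneg (by linarith : 0 ≤ E - 1) (mul_nonneg (by linarith : 0 ≤ E) (sq_nonneg M))]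

/-- vertical strip -/
theorem strip_thin (A B E : ℤ → ℤ) (f : ℤ → ℤ → ℤ) (D X : ℤ) (hb : ∀ x y, D ≤ f x y)
    (hf : ∀ x y, f x y = A x * y ^ 2 + B x * y + E x) :
    ThinV {v | ∃ x y, |x| ≤ X ∧ f x y = v} := by
  refine (ThinV.biUnion (Finset.Icc (-X) X)
    (fun x => {v | ∃ y : ℤ, v = A x * y ^ 2 + B x * y + E x}) ?_).mono ?_
  · intro x _
    exact ThinV.quad (A x) (B x) (E x) D (fun z => by rw [← hf]; exact hb _ _)
  · rintro v ⟨x, y, hx, rfl⟩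
    exact ⟨x, Finset.mem_Icc.2 (abs_le.1 hx), y, hf x y⟩

theorem thin_A1 (a b c d e f g h k l m D : ℤ) (F : ℤ → ℤ → ℤ)
    (hF : ∀ x y, F x y = x ^ 2 * (a * x ^ 2 + b * (x * y) + c * y ^ 2)
      + x * (d * x ^ 2 + e * (x * y) + f * y ^ 2) + (g * x ^ 2 + h * (x * y) + k * y ^ 2)
      + (l * x + m * y))
    (hb : ∀ x y, D ≤ F x y) (hc : 0 < c) (hdisc : b ^ 2 < 4 * a * c) :
    ThinV {v | ∃ x y, F x y = v} := by
  have ha : 0 < a := by nlinarith [sq_nonneg b]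
  set E : ℤ := 4 * (a + c) with hE
  set S : ℤ := |d| + |e| + |f| + (|g| + |h| + |k|) + (|l| + |m|) with hS
  have hS0 : 0 ≤ S := by positivity
  have hE1 : 1 ≤ E := by omega
  set X : ℤ := 4 * E * S + 4 with hX
  have hES : 0 ≤ E * S := by positivity
  refine ((strip_thin (fun x => c * x ^ 2 + f * x + k)
    (fun x => b * x ^ 3 + e * x ^ 2 + h * x + m)
    (fun x => a * x ^ 4 + d * x ^ 3 + g * x ^ 2 + l * x) F D X hb
    (fun x y => by rw [hF]; ring)).union
    (W := {v | ∃ x y, X < |x| ∧ F x y = v}) ?_).mono ?_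
  · apply ThinV.region F (2 * E) (by omega) 0 0
    rintro n hn v ⟨x, y, hx, rfl⟩ hv
    refine ⟨x, y, rfl, Or.inr (Or.inr ?_)⟩
    set s := x ^ 2 + y ^ 2 with hs
    have hs0 : 0 ≤ s := by positivity
    have h1 : s ≤ E * (a * x ^ 2 + b * (x * y) + c * y ^ 2) := by
      have e1 : 4 * c * (a * x ^ 2 + b * (x * y) + c * y ^ 2) =
        (2 * c * y + b * x) ^ 2 + (4 * a * c - b ^ 2) * x ^ 2 := by ring
      have e2 : 4 * a * (a * x ^ 2 + b * (x * y) + c * y ^ 2) =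
        (2 * a * x + b * y) ^ 2 + (4 * a * c - b ^ 2) * y ^ 2 := by ring
      have e3 : x ^ 2 ≤ (4 * a * c - b ^ 2) * x ^ 2 :=
        le_mul_of_one_le_left (sq_nonneg x) (by linarith)
      have e4 : y ^ 2 ≤ (4 * a * c - b ^ 2) * y ^ 2 :=
        le_mul_of_one_le_left (sq_nonneg y) (by linarith)
      have e5 := sq_nonneg (2 * c * y + b * x)
      have e6 := sq_nonneg (2 * a * x + b * y)
      rw [hE, hs]
      linarith
    have h2 : -(S * (|x| * s)) ≤ x * (d * x ^ 2 + e * (x * y) + f * y ^ 2)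
        + (g * x ^ 2 + h * (x * y) + k * y ^ 2) + (l * x + m * y) := by
      have e1 := abs_quad_le d e f x y
      have e2 := neg_le_of_abs_le (abs_quad_le g h k x y)
      have e3 := neg_le_of_abs_le (abs_lin_le l m x y)
      have e4 := mul_le_mul_of_nonneg_left e1 (abs_nonneg x)
      rw [← abs_mul] at e4
      have e5 := neg_le_of_abs_le e4
      have e6 : s ≤ |x| * s := le_mul_of_one_le_left hs0 (by linarith)
      have e7 := mul_le_mul_of_nonneg_left e6 (by positivity : 0 ≤ |g| + |h| + |k|)
      have e8 := mul_le_mul_of_nonneg_left e6 (by positivity : 0 ≤ |l| + |m|)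
      rw [hS]
      linarith
    have h3 : x ^ 2 * s ≤ 2 * (E * F x y) := by
      have e1 := mul_le_mul_of_nonneg_left h1 (sq_nonneg x)
      have e2 := mul_le_mul_of_nonneg_left h2 (by omega : 0 ≤ E)
      have e3 : 2 * (E * S) * (|x| * s) ≤ x ^ 2 * s := by
        rw [← sq_abs x]
        have : 2 * (E * S) ≤ |x| := by linarith
        have := mul_le_mul_of_nonneg_right this (by positivity : 0 ≤ |x| * s)
        linarith
      rw [hF]
      linarith
    have h4 : E * F x y ≤ E * n ^ 4 := mul_le_mul_of_nonneg_left hv (by omega)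
    have hx2 : 1 ≤ x ^ 2 := by
      have : 1 ≤ |x| := by linarith
      rw [← sq_abs]; exact one_le_pow₀ this
    have h5 : (x ^ 2) ^ 2 ≤ 2 * E * (n ^ 2) ^ 2 := by
      have := mul_nonneg (sq_nonneg x) (sq_nonneg y)
      rw [hs] at h3
      linarith [(by ring : x ^ 2 * (x ^ 2 + y ^ 2) = (x ^ 2) ^ 2 + x ^ 2 * y ^ 2)]
    have h6 : y ^ 2 ≤ 2 * E * (n ^ 2) ^ 2 := by
      have e1 := mul_le_mul_of_nonneg_right hx2 hs0
      have e2 := sq_nonneg x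
      rw [hs] at h3 e1
      linarith
    refine ⟨?_, abs_le_of_sq_le' (by omega) (by positivity) h6⟩
    have h7 := abs_le_of_sq_le' (by omega) (by positivity) h5
    rw [abs_of_nonneg (sq_nonneg x)] at h7
    exact abs_le_of_sq_le' (by omega) (by omega) h7
  · rintro v ⟨x, y, rfl⟩
    rcases le_or_gt |x| X with h | h
    · exact Or.inl ⟨x, y, h, rfl⟩
    · exact Or.inr ⟨x, y, h, rfl⟩

theorem thin_A2 (a b c d e f g h k l m D : ℤ) (F : ℤ → ℤ → ℤ)
    (hF : ∀ x y, F x y = x ^ 2 * (a * x ^ 2 + b * (x * y) + c * y ^ 2)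
      + x * (d * x ^ 2 + e * (x * y) + f * y ^ 2) + (g * x ^ 2 + h * (x * y) + k * y ^ 2)
      + (l * x + m * y))
    (hb : ∀ x y, D ≤ F x y) (hc : 0 < c) (hdisc : b ^ 2 = 4 * a * c) :
    ThinV {v | ∃ x y, F x y = v} := by
  -- the identity in terms of `x` and `2cy+bx`
  obtain ⟨d', e', f', g', h', k', l', m', hid⟩ : ∃ d' e' f' g' h' k' l' m' : ℤ, ∀ x y t : ℤ,
      t = 2 * c * y + b * x →
      4 * c ^ 2 * F x y = c * (x ^ 2 * t ^ 2) + d' * x ^ 3 + e' * (x ^ 2 * t) + f' * (x * t ^ 2)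
        + g' * x ^ 2 + h' * (x * t) + k' * t ^ 2 + l' * x + m' * t := by
    refine ⟨4 * c ^ 2 * d - 2 * c * b * e + b ^ 2 * f, 2 * c * e - 2 * b * f, f,
      4 * c ^ 2 * g - 2 * c * b * h + b ^ 2 * k, 2 * c * h - 2 * b * k, k,
      4 * c ^ 2 * l - 2 * c * b * m, 2 * c * m, ?_⟩
    rintro x y t rfl
    rw [hF]
    linear_combination (-c * x ^ 4) * hdisc
  have hd' : d' = 0 := by
    have h1 : d' * (2 * c) ^ 3 = 0 := by
      apply bb3 (c := g' * (2 * c) ^ 2) (e := l' * (2 * c)) (D := 4 * c ^ 2 * D)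
      intro z
      have e1 := hid (2 * c * z) (-b * z) 0 (by ring)
      have e2 := mul_le_mul_of_nonneg_left (hb (2 * c * z) (-b * z)) (by positivity : 0 ≤ 4 * c ^ 2)
      linarith
    have h2 : (2 * c) ^ 3 ≠ 0 := by positivity
    exact (mul_eq_zero.1 h1).resolve_right h2
  subst hd'
  set S : ℤ := |e'| + |f'| + |g'| + |h'| + |k'| + |l'| + |m'| with hS
  have hS0 : 0 ≤ S := by positivity
  set X : ℤ := 2 * S + 2 with hX
  -- horizontal lines
  have hlines : ThinV {v | ∃ x y, |2 * c * y + b * x| ≤ X ∧ F x y = v} := by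
    refine (ThinV.biUnion (Finset.Icc (-X) X)
      (fun t => {v | ∃ x y : ℤ, 2 * c * y + b * x = t ∧ F x y = v}) ?_).mono ?_
    · intro t _
      by_cases hne : ∃ x0 y0 : ℤ, 2 * c * y0 + b * x0 = t
      · obtain ⟨x0, y0, h0⟩ := hne
        set α := c * t ^ 2 + e' * t + g' with hα
        set β := f' * t ^ 2 + h' * t + l' with hβ
        set γ := k' * t ^ 2 + m' * t with hγ
        have key : ∀ x y : ℤ, 2 * c * y + b * x = t →
            4 * c ^ 2 * F x y = α * x ^ 2 + β * x + γ := by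
          intro x y hxy
          rw [hid x y t hxy.symm]
          simp only [hα, hβ, hγ]; ring
        have hbz : ∀ z : ℤ, 4 * c ^ 2 * D - (α * x0 ^ 2 + β * x0 + γ) ≤
            (α * (2 * c) ^ 2) * z ^ 2 + (2 * α * x0 * (2 * c) + β * (2 * c)) * z := by
          intro z
          have e1 := key (x0 + 2 * c * z) (y0 - b * z) (by rw [← h0]; ring)
          have e2 := mul_le_mul_of_nonneg_left (hb (x0 + 2 * c * z) (y0 - b * z))
            (by positivity : 0 ≤ 4 * c ^ 2)
          linarith
        have hα0 : 0 ≤ α := by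
          have := bb2 hbz
          by_contra hneg
          push Not at hneg
          have := mul_neg_of_neg_of_pos hneg (by positivity : 0 < (2 * c) ^ 2)
          linarith
        rcases hα0.lt_or_eq with hα0 | hα0
        · apply ThinV.line (4 * c ^ 2) α β γ (by positivity) hα0
          rintro v ⟨x, y, hxy, rfl⟩
          exact ⟨x, key x y hxy⟩
        · rw [← hα0] at hbz key
          have hβ0 : β * (2 * c) = 0 := by
            apply bb1
            intro z
            have := hbz z
            simp only [zero_mul, mul_zero, zero_add] at this
            exact this
          have hβ1 : β = 0 := (mul_eq_zero.1 hβ0).resolve_right (by positivity)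
          rw [hβ1] at key
          refine (ThinV.singleton (γ / (4 * c ^ 2))).mono ?_
          rintro v ⟨x, y, hxy, rfl⟩
          have := key x y hxy
          simp only [zero_mul, zero_add] at this
          rw [Set.mem_singleton_iff, ← this]
          exact (Int.mul_ediv_cancel_left _ (by positivity)).symm
      · refine ThinV.empty.mono ?_
        rintro v ⟨x, y, hxy, _⟩
        exact hne ⟨x, y, hxy⟩
    · rintro v ⟨x, y, hx, rfl⟩
      exact ⟨_, Finset.mem_Icc.2 (abs_le.1 hx), x, y, rfl, rfl⟩
  refine (((strip_thin (fun x => c * x ^ 2 + f * x + k)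
    (fun x => b * x ^ 3 + e * x ^ 2 + h * x + m)
    (fun x => a * x ^ 4 + d * x ^ 3 + g * x ^ 2 + l * x) F D X hb
    (fun x y => by rw [hF]; ring)).union hlines).union
    (W := {v | ∃ x y, X < |x| ∧ X < |2 * c * y + b * x| ∧ F x y = v}) ?_).mono ?_
  · set E : ℤ := 8 * c ^ 2 with hE
    have hE1 : 1 ≤ E := by have : 0 < c ^ 2 := by positivity
                           omega
    apply ThinV.region F (E + |b| * E) (by positivity) (-(b / (2 * c) : ℝ)) 0
    rintro n hn v ⟨x, y, hx, ht, rfl⟩ hv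
    refine ⟨x, y, rfl, ?_⟩
    have hxt := hid x y _ rfl
    set t := 2 * c * y + b * x with htdef
    have h1 : (x * t) ^ 2 ≤ E * (n ^ 2) ^ 2 := by
      have hx1 : 1 ≤ |x| := by omega
      have ht1 : 1 ≤ |t| := by omega
      -- lower bounds
      have bnd : ∀ (q z : ℤ), |z| ≤ |x| * t ^ 2 ∨ |z| ≤ x ^ 2 * |t| → X * (-(|q| * |z|)) ≤ X * (q * z) ∧
          X * |z| ≤ (x * t) ^ 2 := by
        intro q z hz
        constructor
        · apply mul_le_mul_of_nonneg_left _ (by omega)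
          rw [← abs_mul]; exact neg_abs_le _
        · have hsq : (x * t) ^ 2 = |x| * (|x| * t ^ 2) := by rw [mul_pow, ← sq_abs x]; ring
          have hsq' : (x * t) ^ 2 = |t| * (x ^ 2 * |t|) := by rw [mul_pow, ← sq_abs t]; ring
          rcases hz with hz | hz
          · rw [hsq]; exact mul_le_mul hx.le hz (abs_nonneg _) (abs_nonneg _)
          · rw [hsq']; exact mul_le_mul ht.le hz (abs_nonneg _) (abs_nonneg _)
      have q1 : x ^ 2 ≤ x ^ 2 * |t| := le_mul_of_one_le_right (sq_nonneg _) ht1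
      have q2 : t ^ 2 ≤ |x| * t ^ 2 := le_mul_of_one_le_left (sq_nonneg _) hx1
      have q3 : |x| ≤ x ^ 2 := int_abs_le_sq x
      have q4 : |t| ≤ t ^ 2 := int_abs_le_sq t
      have q5 : |x| * |t| ≤ |x| * t ^ 2 := mul_le_mul_of_nonneg_left q4 (abs_nonneg _)
      obtain ⟨a1, b1⟩ := bnd e' (x ^ 2 * t) (Or.inr (by rw [abs_mul, abs_of_nonneg (sq_nonneg x)]))
      obtain ⟨a2, b2⟩ := bnd f' (x * t ^ 2) (Or.inl (by rw [abs_mul, abs_of_nonneg (sq_nonneg t)]))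
      obtain ⟨a3, b3⟩ := bnd g' (x ^ 2) (Or.inr (by rw [abs_of_nonneg (sq_nonneg x)]; exact q1))
      obtain ⟨a4, b4⟩ := bnd h' (x * t) (Or.inl (by rw [abs_mul]; exact q5))
      obtain ⟨a5, b5⟩ := bnd k' (t ^ 2) (Or.inl (by rw [abs_of_nonneg (sq_nonneg t)]; exact q2))
      obtain ⟨a6, b6⟩ := bnd l' x (Or.inr (q3.trans q1))
      obtain ⟨a7, b7⟩ := bnd m' t (Or.inl (q4.trans q2))
      have c1 := mul_le_mul_of_nonneg_left b1 (abs_nonneg e')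
      have c2 := mul_le_mul_of_nonneg_left b2 (abs_nonneg f')
      have c3 := mul_le_mul_of_nonneg_left b3 (abs_nonneg g')
      have c4 := mul_le_mul_of_nonneg_left b4 (abs_nonneg h')
      have c5 := mul_le_mul_of_nonneg_left b5 (abs_nonneg k')
      have c6 := mul_le_mul_of_nonneg_left b6 (abs_nonneg l')
      have c7 := mul_le_mul_of_nonneg_left b7 (abs_nonneg m')
      have u1 : X * (4 * c ^ 2 * F x y) ≥ X * (c * (x * t) ^ 2) - S * (x * t) ^ 2 := by
        rw [hxt, hS]
        linarith [mul_pow x t 2]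
      have u2 : (x * t) ^ 2 ≤ c * (x * t) ^ 2 := le_mul_of_one_le_left (sq_nonneg _) (by omega)
      have u3 := mul_le_mul_of_nonneg_left u2 (by omega : 0 ≤ X)
      have u4 : X * (x * t) ^ 2 ≤ 2 * (X * (4 * c ^ 2 * F x y)) := by
        have := sq_nonneg (x * t)
        have e1 : X * (x * t) ^ 2 = 2 * (S * (x * t) ^ 2) + 2 * (x * t) ^ 2 := by rw [hX]; ring
        linarith
      have u5 : (x * t) ^ 2 ≤ 2 * (4 * c ^ 2 * F x y) := by
        apply le_of_mul_le_mul_left _ (by omega : 0 < X)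
        linarith
      have u6 := mul_le_mul_of_nonneg_left hv (by positivity : 0 ≤ 8 * c ^ 2)
      rw [hE]
      linarith
    have h2 := abs_le_of_sq_le' hE1 (by positivity) h1
    rw [abs_mul] at h2
    have hx1 : 1 ≤ |x| := by omega
    have ht1 : 1 ≤ |t| := by omega
    have hx2 : |x| ≤ E * n ^ 2 := (le_mul_of_one_le_right (abs_nonneg _) ht1).trans h2
    have ht2 : |t| ≤ E * n ^ 2 := (le_mul_of_one_le_left (abs_nonneg _) hx1).trans h2
    have hbE : 0 ≤ |b| * E := by positivity
    rcases le_or_gt |x| (E * n) with hxs | hxs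
    · refine Or.inr (Or.inr ⟨?_, ?_⟩)
      · have := mul_nonneg hbE (by omega : 0 ≤ n)
        linarith
      · have e1 : |2 * c * y| ≤ |t| + |b| * |x| := by
          rw [← abs_mul, (by rw [htdef]; ring : 2 * c * y = t - b * x)]
          exact abs_sub _ _
        have e2 : |y| ≤ |2 * c * y| := by
          rw [abs_mul]
          apply le_mul_of_one_le_left (abs_nonneg _)
          rw [abs_of_pos (by omega)]; omega
        have e3 := mul_le_mul_of_nonneg_left hx2 (abs_nonneg b)
        linarith
    · have hts : |t| ≤ E * n := by
        by_contra hcon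
        push Not at hcon
        have e1 : (E * n) * (E * n) < |x| * |t| :=
          mul_lt_mul'' hxs hcon (by positivity) (by positivity)
        have e2 : E * n ^ 2 ≤ E * n * (E * n) := by
          have := le_mul_of_one_le_left (by positivity : 0 ≤ E * n ^ 2) hE1
          linarith [(by ring : E * n * (E * n) = E * (E * n ^ 2))]
        linarith
      refine Or.inl ⟨?_, ?_⟩
      · have := mul_nonneg hbE (by positivity : 0 ≤ n ^ 2)
        linarith
      · have hcR : (1 : ℝ) ≤ c := by exact_mod_cast hc
        have e1 : (y : ℝ) - -(b / (2 * c) : ℝ) * x = t / (2 * c) := by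
          rw [htdef]; push_cast; field_simp; ring
        rw [e1, abs_div, abs_of_pos (by linarith : (0 : ℝ) < 2 * c)]
        apply (div_le_self (abs_nonneg _) (by linarith)).trans
        have : |t| ≤ (E + |b| * E) * n := by
          have := mul_nonneg hbE (by omega : 0 ≤ n)
          linarith
        exact_mod_cast this
  · rintro v ⟨x, y, rfl⟩
    rcases le_or_gt |x| X with h | h
    · exact Or.inl (Or.inl ⟨x, y, h, rfl⟩)
    rcases le_or_gt |2 * c * y + b * x| X with h' | h'
    · exact Or.inl (Or.inr ⟨x, y, h', rfl⟩)
    · exact Or.inr ⟨x, y, h, h', rfl⟩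

theorem core_A (a b c d e f g h k l m D : ℤ) (F : ℤ → ℤ → ℤ)
    (hF : ∀ x y, F x y = x ^ 2 * (a * x ^ 2 + b * (x * y) + c * y ^ 2)
      + x * (d * x ^ 2 + e * (x * y) + f * y ^ 2) + (g * x ^ 2 + h * (x * y) + k * y ^ 2)
      + (l * x + m * y))
    (hb : ∀ x y, D ≤ F x y) (hc : c ≠ 0)
    (hpsd : ∀ x y : ℤ, 0 ≤ x ^ 2 * (a * x ^ 2 + b * (x * y) + c * y ^ 2)) :
    ThinV {v | ∃ x y, F x y = v} := by
  have hc0 : 0 ≤ c := by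
    apply bb2 (e := b) (D := -a)
    intro y
    have := hpsd 1 y
    linarith
  have hc1 : 0 < c := by omega
  have h1 := hpsd (2 * c) (-b)
  have h2 : b ^ 2 ≤ 4 * a * c := by
    by_contra hcon
    push Not at hcon
    have : 0 < 4 * c ^ 2 * c * (b ^ 2 - 4 * a * c) := by
      apply mul_pos (by positivity); linarith
    linarith
  rcases h2.lt_or_eq with h2 | h2
  · exact thin_A1 a b c d e f g h k l m D F hF hb hc1 h2
  · exact thin_A2 a b c d e f g h k l m D F hF hb hc1 h2

theorem exists_prime_nonres (d B : ℤ) (hd : 0 < d) :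
    ∃ p : ℕ, p.Prime ∧ B < p ∧ ∀ Z W : ℤ, (p : ℤ) ∣ Z ^ 2 + d * W ^ 2 → (p : ℤ) ∣ W := by
  obtain ⟨n, rfl⟩ : ∃ n : ℕ, d = n := ⟨d.toNat, by omega⟩
  have hn : 0 < n := by exact_mod_cast hd
  have hu : IsUnit ((-1 : ℤ) : ZMod (4 * n)) := by simp
  have : NeZero (4 * n) := ⟨by omega⟩
  obtain ⟨p, hpB, hp, hpm⟩ := Nat.forall_exists_prime_gt_and_eq_mod hu (B.toNat + 2)
  have : Fact p.Prime := ⟨hp⟩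
  refine ⟨p, hp, by omega, ?_⟩
  intro Z W hdvd
  by_contra hW
  have hmod : ((p : ℕ) : ZMod (4 * n)) = ((4 * n - 1 : ℕ) : ZMod (4 * n)) := by
    rw [hpm, Nat.cast_sub (by omega)]
    simp
  rw [ZMod.natCast_eq_natCast_iff'] at hmod
  have hpodd : Odd p := hp.odd_of_ne_two (by omega)
  have hJ : jacobiSym (-(n : ℤ)) p = -1 := by
    rw [jacobiSym.mod_right _ hpodd]
    have : 4 * (-(n : ℤ)).natAbs = 4 * n := by simp
    rw [this, hmod, ← this, ← jacobiSym.mod_right _ (by exact ⟨2 * n - 1, by omega⟩)]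
    have hodd : Odd (4 * n - 1) := ⟨2 * n - 1, by omega⟩
    rw [this, jacobiSym.neg _ hodd, ZMod.χ₄_nat_three_mod_four (by omega)]
    have h4 : jacobiSym (4 * n : ℤ) (4 * n - 1) = 1 := by
      have : (4 * n : ℤ) % ((4 * n - 1 : ℕ) : ℤ) = 1 % ((4 * n - 1 : ℕ) : ℤ) := by
        apply Int.ModEq.eq
        rw [Int.modEq_iff_dvd]
        refine ⟨-1, ?_⟩
        push_cast [Nat.cast_sub (by omega : 1 ≤ 4 * n)]
        ring
      rw [jacobiSym.mod_left' this, jacobiSym.one_left]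
    have h22 : jacobiSym ((2 : ℤ) ^ 2) (4 * n - 1) = 1 := by
      apply jacobiSym.sq_one'
      rw [Int.gcd_eq_natAbs]
      simpa using hodd
    rw [show (4 * n : ℤ) = 2 ^ 2 * n by ring, jacobiSym.mul_left, h22, one_mul] at h4
    rw [h4]; norm_num
  rw [← jacobiSym.legendreSym.to_jacobiSym, legendreSym.eq_neg_one_iff] at hJ
  apply hJ
  have hW' : ((W : ℤ) : ZMod p) ≠ 0 := by
    rwa [Ne, ZMod.intCast_zmod_eq_zero_iff_dvd]
  have h0 : ((Z ^ 2 + (n : ℤ) * W ^ 2 : ℤ) : ZMod p) = 0 := by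
    rwa [ZMod.intCast_zmod_eq_zero_iff_dvd]
  refine ⟨Z / W, ?_⟩
  push_cast at h0 ⊢
  field_simp
  linear_combination -h0

/-- Local obstruction. -/
theorem local_obstruction (V : Set ℤ) (d e K0 C D : ℤ) (hd : 0 < d) (he : 0 < e) (hC : 0 < C)
    (hV : ∀ v ∈ V, ∃ Z W : ℤ, Z ^ 2 + d * W ^ 2 = e * v + K0) : V ≠ targetSet C D := by
  rintro rfl
  obtain ⟨p, hp, hpB, hres⟩ := exists_prime_nonres d (e * C) hd
  have hpI : Prime (p : ℤ) := Nat.prime_iff_prime_int.1 hp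
  have hp0 : (0 : ℤ) < p := by exact_mod_cast hp.pos
  have hcop : IsCoprime (e * C) ((p : ℤ) ^ 2) := by
    apply IsCoprime.pow_right
    rw [isCoprime_comm, hpI.coprime_iff_not_dvd]
    intro hdvd
    have := Int.le_of_dvd (by positivity) hdvd
    omega
  obtain ⟨u, w, huw⟩ := hcop
  -- n ≡ u (p - K0) mod p²
  set n : ℤ := u * (p - K0) + p ^ 2 * (|u * (p - K0)| + |D|) with hn
  have hnD : D ≤ C * n := by
    have h1 : |D| ≤ n := by
      have e1 := neg_abs_le (u * (p - K0))
      have e2 : (|u * (p - K0)| + |D|) ≤ p ^ 2 * (|u * (p - K0)| + |D|) :=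
        le_mul_of_one_le_left (by positivity) (one_le_pow₀ (by omega))
      linarith
    have h2 := le_abs_self D
    have h3 : n ≤ C * n := le_mul_of_one_le_left ((abs_nonneg D).trans h1) (by omega)
    linarith
  obtain ⟨Z, W, hZW⟩ := hV (C * n) ⟨⟨n, rfl⟩, hnD⟩
  have hval : ∃ q : ℤ, Z ^ 2 + d * W ^ 2 = p + p ^ 2 * q := by
    refine ⟨e * C * (|u * (p - K0)| + |D|) - w * (p - K0), ?_⟩
    rw [hZW, hn]
    linear_combination (p - K0) * huw
  obtain ⟨q, hq⟩ := hval
  have hW := hres Z W (by rw [hq]; exact ⟨1 + p * q, by ring⟩)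
  obtain ⟨W', rfl⟩ := hW
  have hZ : (p : ℤ) ∣ Z := by
    apply hpI.dvd_of_dvd_pow (n := 2)
    exact ⟨1 + p * q - d * p * W' ^ 2, by linear_combination hq⟩
  obtain ⟨Z', rfl⟩ := hZ
  have h1 : (p : ℤ) * (p * (Z' ^ 2 + d * W' ^ 2 - q)) = p * 1 := by linear_combination hq
  have h2 := mul_left_cancel₀ hp0.ne' h1
  exact hpI.not_isUnit (IsUnit.of_mul_eq_one _ h2)

set_option maxHeartbeats 2000000 in
theorem core_B (a d e g h k l m C D : ℤ) (hC : 0 < C) (F : ℤ → ℤ → ℤ)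
    (hF : ∀ x y, F x y = a * x ^ 4
      + x ^ 2 * (d * x + e * y) + (g * x ^ 2 + h * (x * y) + k * y ^ 2)
      + (l * x + m * y))
    (hk : k ≠ 0) :
    {v | ∃ x y, F x y = v} ≠ targetSet C D := by
  intro hVT
  have hb : ∀ x y, D ≤ F x y := by
    intro x y
    have : F x y ∈ targetSet C D := by rw [← hVT]; exact ⟨x, y, rfl⟩
    exact this.2
  have hk0 : 0 ≤ k := by
    apply bb2 (e := m) (D := D)
    intro y
    have := hb 0 y
    rw [hF] at this
    linarith
  have hk1 : 0 < k := by omega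
  set P4 := 4 * k * a - e ^ 2 with hP4
  set P3 := 4 * k * d - 2 * e * h with hP3
  set P2 := 4 * k * g - h ^ 2 - 2 * e * m with hP2
  set P1 := 4 * k * l - 2 * h * m with hP1
  have hid : ∀ x y, 4 * k * F x y = (2 * k * y + (e * x ^ 2 + h * x + m)) ^ 2
      + (P4 * x ^ 4 + P3 * x ^ 3 + P2 * x ^ 2 + P1 * x) - m ^ 2 := by
    intro x y
    rw [hF, hP4, hP3, hP2, hP1]; ring
  have hP : ∀ x : ℤ, 4 * k * D - 4 * k ^ 2 + m ^ 2 ≤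
      P4 * x ^ 4 + P3 * x ^ 3 + P2 * x ^ 2 + P1 * x := by
    intro x
    set B := e * x ^ 2 + h * x + m with hB
    have h1 := hid x (-(B / (2 * k)))
    have h2 := hb x (-(B / (2 * k)))
    have h3 := mul_le_mul_of_nonneg_left h2 (by positivity : 0 ≤ 4 * k)
    have h4 : 2 * k * -(B / (2 * k)) + B = B % (2 * k) := by
      have := Int.emod_add_mul_ediv B (2 * k)
      linarith
    rw [← hB, h4] at h1
    have h5 := Int.emod_nonneg B (by omega : 2 * k ≠ 0)
    have h6 := Int.emod_lt_of_pos B (by omega : 0 < 2 * k)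
    have h7 : (B % (2 * k)) ^ 2 ≤ (2 * k) ^ 2 := pow_le_pow_left₀ h5 h6.le 2
    linarith
  have h4 := bb4 hP
  rcases h4.lt_or_eq with h4 | h4
  · -- thin
    apply ThinV.ne_target (C := C) (D := D) hC
    rw [← hVT]
    set S := |P3| + |P2| + |P1| + m ^ 2 with hS
    have hS0 : 0 ≤ S := by positivity
    set L := 4 * k + 2 * S + 1 with hL
    have hm2 := sq_nonneg m
    have hL1 : 1 ≤ L := by omega
    set E := 4 * k + 4 * S * L ^ 3 + 1 with hE
    have hSL : 0 ≤ S * L ^ 3 := by positivity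
    have hE1 : 1 ≤ E := by linarith
    apply ThinV.region F (L + E + |e| * L ^ 2 + |h| * L + |m|) (by positivity) 0 0
    rintro n hn v ⟨x, y, rfl⟩ hv
    refine ⟨x, y, rfl, Or.inr (Or.inr ?_)⟩
    have hid' := hid x y
    set W := 2 * k * y + (e * x ^ 2 + h * x + m) with hW
    have hv' := mul_le_mul_of_nonneg_left hv (by positivity : 0 ≤ 4 * k)
    have c3 : -(|P3| * |x| ^ 3) ≤ P3 * x ^ 3 := by rw [← abs_pow, ← abs_mul]; exact neg_abs_le _
    have c2 : -(|P2| * |x| ^ 2) ≤ P2 * x ^ 2 := by rw [← abs_pow, ← abs_mul]; exact neg_abs_le _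
    have c1 : -(|P1| * |x|) ≤ P1 * x := by rw [← abs_mul]; exact neg_abs_le _
    have c4 : |x| ^ 4 ≤ P4 * x ^ 4 := by
      rw [← abs_pow, abs_of_nonneg (by positivity)]
      exact le_mul_of_one_le_left (by positivity) (by omega)
    have hxL : |x| ≤ L * n := by
      by_contra hcon
      push Not at hcon
      have hLn : L ≤ L * n := le_mul_of_one_le_right (by omega) hn
      have hx1 : 1 ≤ |x| := by linarith
      have p1 : |x| ^ 2 ≤ |x| ^ 3 := pow_le_pow_right₀ hx1 (by norm_num)
      have p2 : |x| ≤ |x| ^ 3 := le_self_pow₀ hx1 (by norm_num)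
      have p3 : 1 ≤ |x| ^ 3 := one_le_pow₀ hx1
      have q1 := mul_le_mul_of_nonneg_left p1 (abs_nonneg P2)
      have q2 := mul_le_mul_of_nonneg_left p2 (abs_nonneg P1)
      have q3 := mul_le_mul_of_nonneg_left p3 hm2
      have r1 : |x| ^ 4 - S * |x| ^ 3 ≤ 4 * k * n ^ 4 := by
        have := sq_nonneg W
        rw [hS]
        linarith
      have r2 : |x| ^ 3 * (L * n - S) ≤ |x| ^ 3 * (|x| - S) :=
        mul_le_mul_of_nonneg_left (by linarith) (by positivity)
      have r3 : (4 * k + 1) * n ≤ L * n - S := by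
        have : S ≤ S * n := le_mul_of_one_le_right hS0 hn
        rw [hL]; linarith
      have r4 : n ^ 3 ≤ |x| ^ 3 := by
        apply pow_le_pow_left₀ (by omega)
        have : n ≤ L * n := le_mul_of_one_le_left (by omega) hL1
        linarith
      have r5 : n ^ 3 * ((4 * k + 1) * n) ≤ |x| ^ 3 * (L * n - S) :=
        mul_le_mul r4 r3 (by positivity) (by positivity)
      have r6 : 0 < n ^ 4 := by positivity
      linarith
    have hx2 : |x| ^ 2 ≤ L ^ 2 * n ^ 2 := by
      rw [← mul_pow]; exact pow_le_pow_left₀ (abs_nonneg _) hxL 2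
    have hn2 : 1 ≤ n ^ 2 := one_le_pow₀ hn
    have hnn2 : n ≤ n ^ 2 := le_self_pow₀ hn (by norm_num)
    have hW2 : W ^ 2 ≤ E * (n ^ 2) ^ 2 := by
      have hM : 1 ≤ L * n := by have := mul_le_mul hL1 hn (by norm_num) (by omega); linarith
      have p1 : |x| ^ 3 ≤ (L * n) ^ 3 := pow_le_pow_left₀ (abs_nonneg _) hxL 3
      have p2 : |x| ^ 2 ≤ (L * n) ^ 3 := (pow_le_pow_left₀ (abs_nonneg _) hxL 2).trans
        (pow_le_pow_right₀ hM (by norm_num))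
      have p3 : |x| ≤ (L * n) ^ 3 := hxL.trans (le_self_pow₀ hM (by norm_num))
      have p4 : 1 ≤ (L * n) ^ 3 := one_le_pow₀ hM
      have q1 := mul_le_mul_of_nonneg_left p1 (abs_nonneg P3)
      have q2 := mul_le_mul_of_nonneg_left p2 (abs_nonneg P2)
      have q3 := mul_le_mul_of_nonneg_left p3 (abs_nonneg P1)
      have q4 := mul_le_mul_of_nonneg_left p4 hm2
      have p5 : 0 ≤ |x| ^ 4 := by positivity
      have r1 : W ^ 2 ≤ 4 * k * n ^ 4 + S * (L * n) ^ 3 := by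
        rw [hS]; linarith
      have r2 : n ^ 3 ≤ n ^ 4 := pow_le_pow_right₀ hn (by norm_num)
      have r3 := mul_le_mul_of_nonneg_left r2 hSL
      have r4 : 0 ≤ n ^ 4 := by positivity
      have r5 := mul_nonneg hSL r4
      rw [hE]
      linarith [mul_pow L n 3]
    have hW3 := abs_le_of_sq_le' hE1 (by positivity) hW2
    have z1 : 0 ≤ |e| * L ^ 2 := by positivity
    have z2 : 0 ≤ |h| * L := by positivity
    have z3 := abs_nonneg m
    constructor
    · refine hxL.trans (mul_le_mul_of_nonneg_right ?_ (by omega))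
      linarith
    · have e2 : |y| ≤ |2 * k * y| := by
        rw [abs_mul]
        apply le_mul_of_one_le_left (abs_nonneg _)
        rw [abs_of_pos (by omega)]; omega
      have e3 : |2 * k * y| ≤ |W| + (|e| * |x| ^ 2 + |h| * |x| + |m|) := by
        rw [← abs_pow, ← abs_mul, ← abs_mul, (by rw [hW]; ring : 2 * k * y = W - (e * x ^ 2 + h * x + m))]
        exact (abs_sub _ _).trans (by gcongr; exact abs_add_three _ _ _)
      have f1 := mul_le_mul_of_nonneg_left hx2 (abs_nonneg e)
      have f2 : |x| ≤ L * n ^ 2 := hxL.trans (mul_le_mul_of_nonneg_left hnn2 (by omega))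
      have f3 := mul_le_mul_of_nonneg_left f2 (abs_nonneg h)
      have f4 : |m| ≤ |m| * n ^ 2 := le_mul_of_one_le_right z3 hn2
      have f5 : 0 ≤ L * n ^ 2 := by positivity
      linarith
  · rw [← h4] at hP hid
    have hP' : ∀ x : ℤ, 4 * k * D - 4 * k ^ 2 + m ^ 2 ≤ P3 * x ^ 3 + P2 * x ^ 2 + P1 * x := by
      intro x; have := hP x; linarith
    have h3 : P3 = 0 := bb3 hP'
    rw [h3] at hP' hid
    have hP'' : ∀ x : ℤ, 4 * k * D - 4 * k ^ 2 + m ^ 2 ≤ P2 * x ^ 2 + P1 * x := by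
      intro x; have := hP' x; linarith
    have h2 := bb2 hP''
    rcases h2.lt_or_eq with h2 | h2
    · refine local_obstruction _ (4 * P2) (16 * k * P2) (P1 ^ 2 + 4 * P2 * m ^ 2) C D (by positivity)
        (by positivity) hC ?_ hVT
      rintro v ⟨x, y, rfl⟩
      refine ⟨2 * P2 * x + P1, 2 * k * y + (e * x ^ 2 + h * x + m), ?_⟩
      linear_combination (-4 * P2) * hid x y
    · rw [← h2] at hP'' hid
      have h1 : P1 = 0 := by
        apply bb1 (D := 4 * k * D - 4 * k ^ 2 + m ^ 2)
        intro x; have := hP'' x; linarith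
      rw [h1] at hid
      apply ThinV.ne_target (C := C) (D := D) hC
      rw [← hVT]
      apply ThinV.line (4 * k) 1 0 (-m ^ 2) (by positivity) one_pos
      rintro v ⟨x, y, rfl⟩
      exact ⟨2 * k * y + (e * x ^ 2 + h * x + m), by rw [hid]; ring⟩

/-- Arbitrarily large Pell units congruent to one. -/
theorem pell_large (d q R : ℤ) (hd : 0 < d) (hsq : ¬ IsSquare d) (hq : 0 < q) :
    ∃ u1 w1 : ℤ, (1 + q * u1) ^ 2 - d * (q * w1) ^ 2 = 1 ∧ R ≤ 1 + q * u1 ∧ 1 ≤ 1 + q * u1 ∧ 0 ≤ w1 := by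
  set m : ℤ := q * (|R| + 1) with hm
  have hR := abs_nonneg R
  have hm0 : 0 < m := by positivity
  have hD : ¬ IsSquare (d * m ^ 2) := by
    rintro ⟨r, hr⟩
    apply hsq
    have h1 : m ^ 2 ∣ r ^ 2 := ⟨d, by linear_combination -hr⟩
    obtain ⟨t, rfl⟩ := (Int.pow_dvd_pow_iff (by norm_num)).1 h1
    refine ⟨t, ?_⟩
    have : m ^ 2 * d = m ^ 2 * (t * t) := by linear_combination hr
    exact mul_left_cancel₀ (by positivity) this
  obtain ⟨u0, w0, h1, hw0⟩ := Pell.exists_of_not_isSquare (by positivity) hD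
  refine ⟨2 * d * (|R| + 1) * m * w0 ^ 2, 2 * (|R| + 1) * |u0 * w0|, ?_, ?_, ?_, by positivity⟩
  · have h2 : |u0 * w0| ^ 2 = (u0 * w0) ^ 2 := sq_abs _
    have h3 : (q * (2 * (|R| + 1) * |u0 * w0|)) ^ 2 = (2 * m) ^ 2 * (u0 * w0) ^ 2 := by
      rw [← h2, hm]; ring
    have h4 : q * (2 * d * (|R| + 1) * m * w0 ^ 2) = 2 * d * m ^ 2 * w0 ^ 2 := by
      rw [hm]; ring
    rw [h3, h4]
    linear_combination (-4 * d * m ^ 2 * w0 ^ 2) * h1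
  · have h1 : 1 ≤ w0 ^ 2 := by
      have : 0 < w0 ^ 2 := by positivity
      omega
    have h4 : q * (2 * d * (|R| + 1) * m * w0 ^ 2) = (|R| + 1) * (q * (2 * d * m * w0 ^ 2)) := by ring
    have h5 : 0 < q * (2 * d * m * w0 ^ 2) := by positivity
    have h6 : (|R| + 1) ≤ (|R| + 1) * (q * (2 * d * m * w0 ^ 2)) :=
      le_mul_of_one_le_right (by positivity) (by omega)
    have := le_abs_self R
    linarith
  · have : 0 ≤ q * (2 * d * (|R| + 1) * m * w0 ^ 2) := by positivity
    linarith

theorem real_growth {A B K : ℝ} (h : ∀ R : ℝ, ∃ ε : ℝ, R ≤ ε ∧ K ≤ A * ε ^ 2 + B * ε) :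
    0 ≤ A ∧ (A = 0 → 0 ≤ B) := by
  constructor
  · by_contra hA
    push Not at hA
    have hA' := hA.ne
    obtain ⟨ε, h1, h2⟩ := h (|B / A| + |K / A| + 1)
    have e1 : A * ε ^ 2 + B * ε - K = A * (ε ^ 2 + (B / A) * ε - K / A) := by
      field_simp
    have e2 : 0 < ε ^ 2 + (B / A) * ε - K / A := by
      have f1 := neg_abs_le (B / A)
      have f2 := le_abs_self (K / A)
      have f3 := abs_nonneg (B / A)
      have f4 := abs_nonneg (K / A)
      have hε : 1 ≤ ε := by linarith
      have f5 : |K / A| + 1 ≤ ε + B / A := by linarith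
      have f6 : 1 * (|K / A| + 1) ≤ ε * (ε + B / A) := mul_le_mul hε f5 (by positivity) (by linarith)
      nlinarith
    nlinarith
  · rintro rfl
    by_contra hB
    push Not at hB
    have hB' := hB.ne
    obtain ⟨ε, h1, h2⟩ := h (K / B + 1)
    have : B * ε ≤ B * (K / B + 1) := mul_le_mul_of_nonpos_left h1 hB.le
    have e : B * (K / B + 1) = K + B := by field_simp
    linarith

/-- Data for the quadratic case, after completing the square.
`X = q x - x0`, `Y = 2γ(q y - y0) + β X`. -/
theorem orbit_step (α β γ d q x0 y0 E κ c0 r0 r1 r2 r3 r4 r5 D : ℤ) (F : ℤ → ℤ → ℤ)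
    (hd : d = β ^ 2 - 4 * α * γ) (hd0 : 0 < d) (hsq : ¬ IsSquare d) (hγ : γ ≠ 0) (hq : 0 < q)
    (hE : 0 < E)
    (hF : ∀ x y X Y : ℤ, X = q * x - x0 → Y = 2 * γ * (q * y - y0) + β * X →
      E * F x y = (κ * (Y ^ 2 - d * X ^ 2) + c0) ^ 2 + (r0 * Y ^ 2 + r1 * (Y * X) + r2 * X ^ 2)
        + (r3 * Y + r4 * X) + r5)
    (hb : ∀ x y, D ≤ F x y) (ρ : ℝ) (hρ : ρ ^ 2 = d) :
    0 < r0 * d + r2 + r1 * ρ ∨ ((r0 * d + r2 + r1 * ρ = 0) ∧ r3 * ρ + r4 = 0) := by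
  have hdR : (0 : ℝ) < d := by exact_mod_cast hd0
  have hρ0 : ρ ≠ 0 := by rintro rfl; norm_num at hρ; linarith
  -- signed statement
  have key : ∀ x y : ℤ, ∀ X Y : ℤ, X = q * x - x0 → Y = 2 * γ * (q * y - y0) + β * X →
      0 ≤ (r0 * d + r2 + r1 * ρ) * (Y + ρ * X : ℝ) ^ 2 ∧
      ((r0 * d + r2 + r1 * ρ) * (Y + ρ * X : ℝ) ^ 2 = 0 →
        0 ≤ 2 * ρ * (r3 * ρ + r4) * (Y + ρ * X : ℝ)) := by
    intro x y X Y hX hY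
    set t : ℝ := Y + ρ * X with ht
    set s : ℝ := Y - ρ * X with hs
    set M0 : ℝ := (κ * (Y ^ 2 - d * X ^ 2) + c0) ^ 2 + r5 with hM0
    set a1 : ℝ := r0 * d + r2 - r1 * ρ with ha1
    set l1 : ℝ := 2 * ρ * (r3 * ρ - r4) with hl1
    apply real_growth (K := 4 * d * (E * D - M0) - 2 * (r0 * d - r2) * (s * t) - |a1| * s ^ 2 - |l1 * s|)
    intro R
    obtain ⟨u1, w1, hp, hR, hu1', hw⟩ := pell_large d q (⌈R⌉ + 1) hd0 hsq hq
    obtain ⟨w, hwabs, hwρ⟩ : ∃ w : ℤ, w ^ 2 = w1 ^ 2 ∧ 0 ≤ (w : ℝ) * ρ := by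
      have hwR : (0 : ℝ) ≤ w1 := by exact_mod_cast hw
      rcases le_total 0 ρ with h | h
      · exact ⟨w1, rfl, mul_nonneg hwR h⟩
      · refine ⟨-w1, by ring, ?_⟩
        push_cast
        nlinarith
    set u : ℤ := 1 + q * u1 with hu
    have hp' : u ^ 2 - d * (q * w) ^ 2 = 1 := by rw [mul_pow, hwabs, ← mul_pow]; exact hp
    have hRε : R + 1 ≤ (u : ℝ) := by
      have h1 := Int.le_ceil R
      have h2 : ((⌈R⌉ + 1 : ℤ) : ℝ) ≤ (u : ℝ) := by exact_mod_cast hR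
      push_cast at h2
      linarith
    have hqR : (0 : ℝ) < q := by exact_mod_cast hq
    set ε : ℝ := u + q * w * ρ with hε
    set ε' : ℝ := u - q * w * ρ with hε'
    have hεε : ε * ε' = 1 := by
      have : ((u : ℝ) ^ 2 - d * (q * w) ^ 2) = 1 := by exact_mod_cast hp'
      rw [hε, hε']
      linear_combination this - (q * w : ℝ) ^ 2 * hρ
    have hqwρ : 0 ≤ q * w * ρ := by rw [mul_assoc]; positivity
    have hu1 : (1 : ℝ) ≤ u := by exact_mod_cast hu1'
    have hε1 : 1 ≤ ε := by linarith
    have hε'0 : 0 ≤ ε' ∧ ε' ≤ 1 := by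
      have : ε' = 1 / ε := by field_simp; linarith
      rw [this]
      exact ⟨by positivity, by rw [div_le_one (by linarith)]; exact hε1⟩
    refine ⟨ε, by linarith, ?_⟩
    -- new point
    set X' : ℤ := u * X + q * w * Y with hX'
    set Y' : ℤ := u * Y + d * (q * w) * X with hY'
    have hval := hF (x + u1 * X + w * Y)
      (y + u1 * (q * y - y0) - w * (2 * α * X + β * (q * y - y0))) X' Y'
      (by rw [hX', hu]; linear_combination hX)
      (by rw [hY', hX', hu, hd]; linear_combination (1 + q * u1 - β * q * w) * hY)
    have hbv := hb (x + u1 * X + w * Y)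
      (y + u1 * (q * y - y0) - w * (2 * α * X + β * (q * y - y0)))
    have hbv' := mul_le_mul_of_nonneg_left hbv hE.le
    rw [hval] at hbv'
    have hinv : Y' ^ 2 - d * X' ^ 2 = Y ^ 2 - d * X ^ 2 := by
      rw [hX', hY']; linear_combination (Y ^ 2 - d * X ^ 2) * hp'
    rw [hinv] at hbv'
    have hbR : (E : ℝ) * D ≤ (κ * (Y ^ 2 - d * X ^ 2) + c0) ^ 2 + (r0 * Y' ^ 2 + r1 * (Y' * X') + r2 * X' ^ 2)
        + (r3 * Y' + r4 * X') + r5 := by exact_mod_cast hbv'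
    have ht' : (Y' : ℝ) + ρ * X' = ε * t := by
      rw [hY', hX', hε, ht]; push_cast
      linear_combination (-(q * w * X : ℝ)) * hρ
    have hs' : (Y' : ℝ) - ρ * X' = ε' * s := by
      rw [hY', hX', hε', hs]; push_cast
      linear_combination (-(q * w * X : ℝ)) * hρ
    have hst : s * t = Y ^ 2 - d * X ^ 2 := by
      rw [hs, ht]; linear_combination (-(X : ℝ) ^ 2) * hρ
    have hst' : (ε' * s) * (ε * t) = s * t := by linear_combination (s * t) * hεε
    have hquad : 4 * d * (r0 * (Y' : ℝ) ^ 2 + r1 * (Y' * X') + r2 * X' ^ 2 + (r3 * Y' + r4 * X')) =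
        (r0 * d + r2 + r1 * ρ) * (ε * t) ^ 2 + a1 * (ε' * s) ^ 2 + 2 * (r0 * d - r2) * (s * t)
          + 2 * ρ * (r3 * ρ + r4) * (ε * t) + l1 * (ε' * s) := by
      rw [← hst', ← ht', ← hs', ha1, hl1, ← hρ]; ring
    have b1 : a1 * (ε' * s) ^ 2 ≤ |a1| * s ^ 2 := by
      have : (ε' * s) ^ 2 ≤ s ^ 2 := by
        rw [mul_pow]
        exact mul_le_of_le_one_left (sq_nonneg s) (pow_le_one₀ hε'0.1 hε'0.2)
      exact mul_le_mul (le_abs_self _) this (by positivity) (by positivity)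
    have b2 : l1 * (ε' * s) ≤ |l1 * s| := by
      have e1 : l1 * (ε' * s) = ε' * (l1 * s) := by ring
      rw [e1]
      calc ε' * (l1 * s) ≤ ε' * |l1 * s| := mul_le_mul_of_nonneg_left (le_abs_self _) hε'0.1
        _ ≤ |l1 * s| := mul_le_of_le_one_left (abs_nonneg _) hε'0.2
    have hb4 := mul_le_mul_of_nonneg_left hbR (by positivity : (0 : ℝ) ≤ 4 * d)
    rw [hM0]
    linarith
  -- points with t large positive or negative
  have hpts : ∀ B : ℝ, ∃ x y X Y : ℤ, X = q * x - x0 ∧ Y = 2 * γ * (q * y - y0) + β * X ∧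
      B ≤ (Y + ρ * X : ℝ) := by
    intro B
    set B0 : ℝ := 2 * γ * (- y0) + β * (-x0) + ρ * (-x0) with hB0
    have hgq : 1 ≤ γ ^ 2 := by have : 0 < γ ^ 2 := by positivity
                               omega
    refine ⟨0, γ * ⌈|B - B0|⌉, _, _, rfl, rfl, ?_⟩
    push_cast
    have h1 := Int.le_ceil |B - B0|
    have h2 : (1 : ℝ) ≤ 2 * γ ^ 2 * q := by
      have : 1 ≤ 2 * γ ^ 2 * q := by nlinarith
      exact_mod_cast this
    have h3 : |B - B0| ≤ 2 * γ ^ 2 * q * ⌈|B - B0|⌉ := by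
      have h4 := abs_nonneg (B - B0)
      nlinarith
    have h5 := le_abs_self (B - B0)
    rw [hB0] at *
    linarith
  have hptn : ∀ B : ℝ, ∃ x y X Y : ℤ, X = q * x - x0 ∧ Y = 2 * γ * (q * y - y0) + β * X ∧
      (Y + ρ * X : ℝ) ≤ B := by
    intro B
    set B0 : ℝ := 2 * γ * (- y0) + β * (-x0) + ρ * (-x0) with hB0
    have hgq : 1 ≤ γ ^ 2 := by have : 0 < γ ^ 2 := by positivity
                               omega
    refine ⟨0, -γ * ⌈|B - B0|⌉, _, _, rfl, rfl, ?_⟩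
    push_cast
    have h1 := Int.le_ceil |B - B0|
    have h2 : (1 : ℝ) ≤ 2 * γ ^ 2 * q := by
      have : 1 ≤ 2 * γ ^ 2 * q := by nlinarith
      exact_mod_cast this
    have h3 : |B - B0| ≤ 2 * γ ^ 2 * q * ⌈|B - B0|⌉ := by
      have h4 := abs_nonneg (B - B0)
      nlinarith
    have h5 := neg_abs_le (B - B0)
    rw [hB0] at *
    linarith
  obtain ⟨x1, y1, X1, Y1, hX1, hY1, ht1⟩ := hpts 1
  obtain ⟨x2, y2, X2, Y2, hX2, hY2, ht2⟩ := hptn (-1)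
  obtain ⟨k1, k2⟩ := key x1 y1 X1 Y1 hX1 hY1
  obtain ⟨k3, k4⟩ := key x2 y2 X2 Y2 hX2 hY2
  have hpos : 0 < (Y1 + ρ * X1 : ℝ) ^ 2 := by positivity
  have hg : 0 ≤ r0 * d + r2 + r1 * ρ := by
    by_contra hcon
    push Not at hcon
    have := mul_neg_of_neg_of_pos hcon hpos
    linarith
  rcases hg.lt_or_eq with hg | hg
  · exact Or.inl hg
  · refine Or.inr ⟨hg.symm, ?_⟩
    have e1 := k2 (by rw [← hg]; ring)
    have e2 := k4 (by rw [← hg]; ring)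
    have e3 : 0 ≤ 2 * ρ * (r3 * ρ + r4) := by
      by_contra hcon
      push Not at hcon
      nlinarith
    have e4 : 2 * ρ * (r3 * ρ + r4) ≤ 0 := by
      by_contra hcon
      push Not at hcon
      nlinarith
    have e5 : 2 * ρ * (r3 * ρ + r4) = 0 := le_antisymm e4 e3
    exact (mul_eq_zero.1 e5).resolve_left (by positivity)

theorem half_quad {A : ℝ} (hA : 0 < A) (B z : ℝ) :
    A / 2 * z ^ 2 - B ^ 2 / (2 * A) ≤ A * z ^ 2 + B * z := by
  have : A * z ^ 2 + B * z - (A / 2 * z ^ 2 - B ^ 2 / (2 * A)) = (A * z + B) ^ 2 / (2 * A) := by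
    field_simp; ring
  have h2 : 0 ≤ (A * z + B) ^ 2 / (2 * A) := by positivity
  linarith

theorem sq_bound {A B z N : ℝ} (hA : 0 < A) (hB : 0 ≤ B) (hN : 0 ≤ N) (h : A * z ^ 2 ≤ B * N ^ 2) :
    |z| ≤ (B / A + 1) * N := by
  apply abs_le_of_sq_le_sq _ (by positivity)
  have h1 : z ^ 2 ≤ B / A * N ^ 2 := by
    rw [div_mul_eq_mul_div, le_div_iff₀ hA]; linarith
  have h2 : 0 ≤ B / A := by positivity
  have h3 : 0 ≤ (B / A) ^ 2 * N ^ 2 + B / A * N ^ 2 + N ^ 2 := by positivity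
  nlinarith

set_option maxHeartbeats 2000000 in
theorem thin_pos (β γ d q x0 y0 E κ c0 r0 r1 r2 r3 r4 r5 : ℤ) (F : ℤ → ℤ → ℤ)
    (hd0 : 0 < d) (hγ : γ ≠ 0) (hq : 0 < q)
    (hE : 0 < E) (hκ : κ ≠ 0)
    (hF : ∀ x y X Y : ℤ, X = q * x - x0 → Y = 2 * γ * (q * y - y0) + β * X →
      E * F x y = (κ * (Y ^ 2 - d * X ^ 2) + c0) ^ 2 + (r0 * Y ^ 2 + r1 * (Y * X) + r2 * X ^ 2)
        + (r3 * Y + r4 * X) + r5)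
    (ρ : ℝ) (hρ : ρ ^ 2 = d) (hρ0 : 0 < ρ)
    (hp : 0 < r0 * d + r2 + r1 * ρ) (hm : 0 < r0 * d + r2 - r1 * ρ) :
    ThinV {v | ∃ x y, F x y = v} := by
  have hdR : (1 : ℝ) ≤ d := by exact_mod_cast hd0
  have hER : (0 : ℝ) < E := by exact_mod_cast hE
  have hκR : (0 : ℝ) < (κ : ℝ) ^ 2 := by
    have : (κ : ℝ) ≠ 0 := by exact_mod_cast hκ
    positivity
  have hqR : (1 : ℝ) ≤ q := by exact_mod_cast hq
  have hγR : (1 : ℝ) ≤ |(γ : ℝ)| := by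
    have : 1 ≤ |γ| := Int.one_le_abs hγ
    exact_mod_cast this
  have hρ1 : 1 ≤ ρ := by nlinarith
  obtain ⟨A0, hA0⟩ : ∃ z : ℝ, z = 4 * d * κ ^ 2 := ⟨_, rfl⟩
  obtain ⟨B0, hB0⟩ : ∃ z : ℝ, z = 8 * d * κ * c0 + 2 * (r0 * d - r2) := ⟨_, rfl⟩
  obtain ⟨A1, hA1⟩ : ∃ z : ℝ, z = r0 * d + r2 + r1 * ρ := ⟨_, rfl⟩
  obtain ⟨B1, hB1⟩ : ∃ z : ℝ, z = 2 * ρ * (r3 * ρ + r4) := ⟨_, rfl⟩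
  obtain ⟨A2, hA2⟩ : ∃ z : ℝ, z = r0 * d + r2 - r1 * ρ := ⟨_, rfl⟩
  obtain ⟨B2, hB2⟩ : ∃ z : ℝ, z = 2 * ρ * (r3 * ρ - r4) := ⟨_, rfl⟩
  have hA0p : 0 < A0 := by rw [hA0]; positivity
  rw [← hA1] at hp
  rw [← hA2] at hm
  obtain ⟨T, hT⟩ : ∃ z : ℝ, z = 4 * d * E + B0 ^ 2 / (2 * A0) + B1 ^ 2 / (2 * A1) + B2 ^ 2 / (2 * A2) +
    |(4 * (d : ℝ) * ((c0 : ℝ) ^ 2 + (r5 : ℝ)))| := ⟨_, rfl⟩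
  have hT0 : 0 ≤ T := by rw [hT]; positivity
  obtain ⟨L, hL⟩ : ∃ z : ℝ, z = (T / (A0 / 2) + 1) + (T / (A1 / 2) + 1) + (T / (A2 / 2) + 1) := ⟨_, rfl⟩
  have hL0 : 0 ≤ T / (A0 / 2) := by positivity
  have hL1 : 0 ≤ T / (A1 / 2) := by positivity
  have hL2 : 0 ≤ T / (A2 / 2) := by positivity
  obtain ⟨S1, hS1⟩ : ∃ z : ℝ, z = 2 * γ * y0 + (β + ρ) * x0 := ⟨_, rfl⟩
  obtain ⟨S2, hS2⟩ : ∃ z : ℝ, z = 2 * γ * y0 + (β - ρ) * x0 := ⟨_, rfl⟩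
  obtain ⟨K, hK⟩ : ∃ z : ℤ, z = ⌈L + |(x0 : ℝ)| + |S1| + |S2|⌉ := ⟨_, rfl⟩
  have hKR : L + |(x0 : ℝ)| + |S1| + |S2| ≤ K := by rw [hK]; exact Int.le_ceil _
  have a1 := abs_nonneg (x0 : ℝ)
  have a2 := abs_nonneg S1
  have a3 := abs_nonneg S2
  have hKR0 : (0 : ℝ) ≤ K := by linarith
  have hK0 : 0 ≤ K := by exact_mod_cast hKR0
  apply ThinV.region F K hK0 (-(β + ρ) / (2 * γ)) (-(β - ρ) / (2 * γ))
  rintro n hn v ⟨x, y, rfl⟩ hv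
  refine ⟨x, y, rfl, ?_⟩
  obtain ⟨X, hX⟩ : ∃ z : ℤ, z = q * x - x0 := ⟨_, rfl⟩
  obtain ⟨Y, hY⟩ : ∃ z : ℤ, z = 2 * γ * (q * y - y0) + β * X := ⟨_, rfl⟩
  have hval := hF x y X Y hX hY
  have hnR : (1 : ℝ) ≤ n := by exact_mod_cast hn
  have hvR : (F x y : ℝ) ≤ n ^ 4 := by exact_mod_cast hv
  have hvalR : (E : ℝ) * F x y = (κ * (Y ^ 2 - d * X ^ 2) + c0) ^ 2 + (r0 * Y ^ 2 + r1 * (Y * X) + r2 * X ^ 2)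
        + (r3 * Y + r4 * X) + r5 := by exact_mod_cast hval
  obtain ⟨t, ht⟩ : ∃ z : ℝ, z = Y + ρ * X := ⟨_, rfl⟩
  obtain ⟨s, hs⟩ : ∃ z : ℝ, z = Y - ρ * X := ⟨_, rfl⟩
  have hst : s * t = Y ^ 2 - d * X ^ 2 := by
    rw [hs, ht]; linear_combination (-(X : ℝ) ^ 2) * hρ
  have hid : 4 * d * ((E : ℝ) * F x y) = (A0 * (s * t) ^ 2 + B0 * (s * t)) + (A1 * t ^ 2 + B1 * t)
      + (A2 * s ^ 2 + B2 * s) + 4 * d * (c0 ^ 2 + r5) := by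
    rw [hvalR, ← hst, hA0, hB0, hA1, hB1, hA2, hB2, hs, ht, ← hρ]; ring
  have i0 := half_quad hA0p B0 (s * t)
  have i1 := half_quad hp B1 t
  have i2 := half_quad hm B2 s
  have hn4 : (1 : ℝ) ≤ n ^ 4 := one_le_pow₀ hnR
  have hub : A0 / 2 * (s * t) ^ 2 + A1 / 2 * t ^ 2 + A2 / 2 * s ^ 2 ≤ T * (n ^ 2) ^ 2 := by
    have e1 : 4 * d * ((E : ℝ) * F x y) ≤ 4 * d * (E * n ^ 4) := by gcongr
    have e2 := neg_abs_le (4 * d * (c0 ^ 2 + r5) : ℝ)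
    have e3 : 0 ≤ B0 ^ 2 / (2 * A0) + B1 ^ 2 / (2 * A1) + B2 ^ 2 / (2 * A2) +
      |(4 * d * (c0 ^ 2 + r5) : ℝ)| := by positivity
    have e4 := le_mul_of_one_le_right e3 hn4
    have e5 : T * ((n : ℝ) ^ 2) ^ 2 = 4 * d * (E * n ^ 4) + (B0 ^ 2 / (2 * A0) + B1 ^ 2 / (2 * A1) + B2 ^ 2 / (2 * A2) +
      |(4 * d * (c0 ^ 2 + r5) : ℝ)|) * n ^ 4 := by rw [hT]; ring
    rw [e5]
    linarith
  have p0 : 0 ≤ A0 / 2 * (s * t) ^ 2 := by positivity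
  have p1 : 0 ≤ A1 / 2 * t ^ 2 := by positivity
  have p2 : 0 ≤ A2 / 2 * s ^ 2 := by positivity
  have hn20 : (0 : ℝ) ≤ (n : ℝ) ^ 2 := by positivity
  have b0 := sq_bound (by positivity : 0 < A0 / 2) hT0 hn20 (by linarith : A0 / 2 * (s * t) ^ 2 ≤ T * ((n : ℝ) ^ 2) ^ 2)
  have b1 := sq_bound (by positivity : 0 < A1 / 2) hT0 hn20 (by linarith : A1 / 2 * t ^ 2 ≤ T * ((n : ℝ) ^ 2) ^ 2)
  have b2 := sq_bound (by positivity : 0 < A2 / 2) hT0 hn20 (by linarith : A2 / 2 * s ^ 2 ≤ T * ((n : ℝ) ^ 2) ^ 2)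
  have b0' : |s * t| ≤ L * n ^ 2 := b0.trans (mul_le_mul_of_nonneg_right (by linarith) hn20)
  have b1' : |t| ≤ L * n ^ 2 := b1.trans (mul_le_mul_of_nonneg_right (by linarith) hn20)
  have b2' : |s| ≤ L * n ^ 2 := b2.trans (mul_le_mul_of_nonneg_right (by linarith) hn20)
  have hL3 : 1 ≤ L := by linarith
  -- bound on x
  have hxR : |(x : ℝ)| ≤ K * n ^ 2 := by
    have e1 : 2 * ρ * X = t - s := by rw [ht, hs]; ring
    have e2 : |(X : ℝ)| ≤ L * n ^ 2 := by
      have f1 : |2 * ρ * X| ≤ 2 * (L * n ^ 2) := by rw [e1]; linarith [abs_sub t s]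
      rw [abs_mul, abs_of_pos (by positivity : 0 < 2 * ρ)] at f1
      have := le_mul_of_one_le_left (abs_nonneg (X : ℝ)) hρ1
      linarith
    have e3 : (q : ℝ) * x = X + x0 := by rw [hX]; push_cast; ring
    have e4 : |(q : ℝ) * x| ≤ L * n ^ 2 + |(x0 : ℝ)| := by
      rw [e3]; linarith [abs_add_le (X : ℝ) x0]
    rw [abs_mul, abs_of_pos (by linarith)] at e4
    have e5 := le_mul_of_one_le_left (abs_nonneg (x : ℝ)) hqR
    have e6 := le_mul_of_one_le_right a1 (one_le_pow₀ hnR : (1 : ℝ) ≤ n ^ 2)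
    have e7 : (L + |(x0 : ℝ)|) * n ^ 2 ≤ K * n ^ 2 := mul_le_mul_of_nonneg_right (by linarith) hn20
    linarith
  have hx : |x| ≤ K * n ^ 2 := by exact_mod_cast hxR
  have hγ0 : (γ : ℝ) ≠ 0 := by exact_mod_cast hγ
  have hlin : ∀ σ z S : ℝ, z = Y + σ * X → S = 2 * γ * y0 + (β + σ) * x0 → |z| ≤ L * n → L + |S| ≤ K →
      |(y : ℝ) - -(β + σ) / (2 * γ) * x| ≤ K * n := by
    intro σ z S hz hS hzL hLS
    have e1 : 2 * γ * q * ((y : ℝ) - -(β + σ) / (2 * γ) * x) = z + S := by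
      rw [hz, hS, hY, hX]; push_cast; field_simp; ring
    have e2 : |2 * γ * q * ((y : ℝ) - -(β + σ) / (2 * γ) * x)| ≤ L * n + |S| := by
      rw [e1]; linarith [abs_add_le z S]
    rw [abs_mul] at e2
    have e3 : (1 : ℝ) ≤ |2 * (γ : ℝ) * (q : ℝ)| := by
      rw [abs_mul, abs_mul, abs_of_pos (by linarith : (0 : ℝ) < q)]
      norm_num
      nlinarith
    have e4 := le_mul_of_one_le_left (abs_nonneg ((y : ℝ) - -(β + σ) / (2 * γ) * x)) e3
    have e5 := le_mul_of_one_le_right (abs_nonneg S) hnR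
    have e6 : (L + |S|) * n ≤ K * n := mul_le_mul_of_nonneg_right hLS (by linarith)
    linarith
  rcases le_or_gt |t| (L * n) with h | h
  · exact Or.inl ⟨hx, hlin ρ t S1 ht hS1 h (by linarith)⟩
  · have h' : |s| ≤ L * n := by
      by_contra hcon
      push Not at hcon
      have e1 : (L * n) * (L * n) < |s| * |t| := mul_lt_mul'' hcon h (by positivity) (by positivity)
      rw [← abs_mul] at e1
      have e2 : L * n ^ 2 ≤ L * (L * n ^ 2) := le_mul_of_one_le_left (by positivity) hL3
      linarith
    have := hlin (-ρ) s S2 (by rw [hs]; ring) (by rw [hS2]; ring) h' (by linarith)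
    rw [← sub_eq_add_neg] at this
    exact Or.inr (Or.inl ⟨hx, this⟩)

theorem core_C (a α β γ m1 m2 q1 q2 q3 l1 l2 D : ℤ) (F : ℤ → ℤ → ℤ)
    (hF : ∀ x y, F x y = a * (α * x ^ 2 + β * (x * y) + γ * y ^ 2) ^ 2
      + (α * x ^ 2 + β * (x * y) + γ * y ^ 2) * (m1 * x + m2 * y)
      + (q1 * x ^ 2 + q2 * (x * y) + q3 * y ^ 2) + (l1 * x + l2 * y))
    (hb : ∀ x y, D ≤ F x y) (ha : 0 < a) (hd0 : 0 < β ^ 2 - 4 * α * γ)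
    (hsq : ¬ IsSquare (β ^ 2 - 4 * α * γ)) :
    ThinV {v | ∃ x y, F x y = v} := by
  have hγ : γ ≠ 0 := by
    rintro rfl
    exact hsq ⟨β, by ring⟩
  obtain ⟨d, hd⟩ : ∃ d, d = β ^ 2 - 4 * α * γ := ⟨_, rfl⟩
  rw [← hd] at hd0 hsq
  obtain ⟨q, hq⟩ : ∃ q, q = 2 * a * d := ⟨_, rfl⟩
  obtain ⟨x0, hx0⟩ : ∃ x0, x0 = 2 * γ * m1 - β * m2 := ⟨_, rfl⟩
  obtain ⟨y0, hy0⟩ : ∃ y0, y0 = 2 * α * m2 - β * m1 := ⟨_, rfl⟩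
  have hq0 : 0 < q := by rw [hq]; positivity
  obtain ⟨A1, hA1⟩ : ∃ z, z = 4 * a * q1 - m1 ^ 2 := ⟨_, rfl⟩
  obtain ⟨A2, hA2⟩ : ∃ z, z = 4 * a * q2 - 2 * m1 * m2 := ⟨_, rfl⟩
  obtain ⟨A3, hA3⟩ : ∃ z, z = 4 * a * q3 - m2 ^ 2 := ⟨_, rfl⟩
  set E : ℤ := 4 * a * (4 * γ * q ^ 2) ^ 2 with hE
  have hE0 : 0 < E := by positivity
  obtain ⟨κ, c0, r0, r1, r2, r3, r4, r5, hκ, hid⟩ : ∃ κ c0 r0 r1 r2 r3 r4 r5 : ℤ, κ ≠ 0 ∧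
      ∀ x y X Y : ℤ, X = q * x - x0 → Y = 2 * γ * (q * y - y0) + β * X →
      E * F x y = (κ * (Y ^ 2 - d * X ^ 2) + c0) ^ 2 + (r0 * Y ^ 2 + r1 * (Y * X) + r2 * X ^ 2)
        + (r3 * Y + r4 * X) + r5 := by
    refine ⟨2 * a, -8 * a * γ * (α * x0 ^ 2 + β * (x0 * y0) + γ * y0 ^ 2),
      4 * q ^ 2 * A3, 4 * q ^ 2 * (2 * γ * A2 - 2 * β * A3),
      4 * q ^ 2 * (4 * γ ^ 2 * A1 - 2 * γ * β * A2 + β ^ 2 * A3),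
      4 * q ^ 2 * (2 * γ * A2 * x0 + 4 * γ * A3 * y0) + 32 * a * γ * q ^ 3 * l2,
      4 * q ^ 2 * (8 * γ ^ 2 * A1 * x0 + A2 * (2 * γ) * (2 * γ * y0 - β * x0) - 4 * β * γ * A3 * y0)
        + 32 * a * γ * q ^ 3 * (2 * γ * l1 - β * l2),
      4 * q ^ 2 * (4 * γ ^ 2 * A1 * x0 ^ 2 + 4 * γ ^ 2 * A2 * x0 * y0 + 4 * γ ^ 2 * A3 * y0 ^ 2)
        + 32 * a * γ * q ^ 3 * (2 * γ * l1 * x0 + 2 * γ * l2 * y0), by positivity, ?_⟩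
    intro x y X Y hX hY
    have hW : 2 * a * (Y ^ 2 - d * X ^ 2) + -8 * a * γ * (α * x0 ^ 2 + β * (x0 * y0) + γ * y0 ^ 2)
        = 4 * γ * q ^ 2 * (2 * a * (α * x ^ 2 + β * (x * y) + γ * y ^ 2) + (m1 * x + m2 * y)) := by
      have e1 : Y ^ 2 - d * X ^ 2 = 4 * γ * (α * (q * x - x0) ^ 2 + β * ((q * x - x0) * (q * y - y0))
          + γ * (q * y - y0) ^ 2) := by
        rw [hY, hX, hd]; ring
      rw [e1]
      have e2 : 2 * α * x0 + β * y0 = -d * m1 := by rw [hx0, hy0, hd]; ring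
      have e3 : β * x0 + 2 * γ * y0 = -d * m2 := by rw [hx0, hy0, hd]; ring
      linear_combination (-8 * a * γ * q * x) * e2 + (-8 * a * γ * q * y) * e3
        - 4 * γ * q * (m1 * x + m2 * y) * hq
    rw [hW, hF, hE, hY, hX, hA1, hA2, hA3]
    ring
  obtain ⟨ρ, hρ⟩ : ∃ ρ : ℝ, ρ = √(d : ℝ) := ⟨_, rfl⟩
  have hdR : (0 : ℝ) < d := by exact_mod_cast hd0
  have hρ2 : ρ ^ 2 = d := by rw [hρ]; exact Real.sq_sqrt hdR.le
  have hρ0 : 0 < ρ := by rw [hρ]; exact Real.sqrt_pos.2 hdR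
  have hirr : Irrational ρ := by
    rw [hρ]
    exact irrational_sqrt_intCast_iff.2 ⟨hsq, hd0.le⟩
  have hind : ∀ u v : ℤ, (u : ℝ) + v * ρ = 0 → u = 0 ∧ v = 0 := by
    intro u v huv
    have hv : v = 0 := by
      by_contra hv
      have hvR : (v : ℝ) ≠ 0 := by exact_mod_cast hv
      apply hirr
      refine ⟨-u / v, ?_⟩
      push_cast
      field_simp
      linarith
    subst hv
    simp at huv
    exact ⟨huv, rfl⟩
  have o1 := orbit_step α β γ d q x0 y0 E κ c0 r0 r1 r2 r3 r4 r5 D F hd hd0 hsq hγ hq0 hE0 hid hb ρ hρ2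
  have o2 := orbit_step α β γ d q x0 y0 E κ c0 r0 r1 r2 r3 r4 r5 D F hd hd0 hsq hγ hq0 hE0 hid hb (-ρ)
    (by rw [neg_sq]; exact hρ2)
  have hdeg : ∀ σ : ℝ, (σ = ρ ∨ σ = -ρ) → (r0 * d + r2 + r1 * σ = 0) ∧ r3 * σ + r4 = 0 →
      ThinV {v | ∃ x y, F x y = v} := by
    rintro σ hσ ⟨g1, g2⟩
    have hz : r0 * d + r2 = 0 ∧ r1 = 0 ∧ r3 = 0 ∧ r4 = 0 := by
      rcases hσ with rfl | rfl
      · obtain ⟨z1, z2⟩ := hind (r0 * d + r2) r1 (by push_cast; linarith)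
        obtain ⟨z3, z4⟩ := hind r4 r3 (by linarith)
        exact ⟨z1, z2, z4, z3⟩
      · obtain ⟨z1, z2⟩ := hind (r0 * d + r2) (-r1) (by push_cast; linarith)
        obtain ⟨z3, z4⟩ := hind r4 (-r3) (by push_cast; linarith)
        exact ⟨z1, by omega, by omega, z3⟩
    obtain ⟨z1, z2, z3, z4⟩ := hz
    apply ThinV.line E (κ ^ 2) (2 * κ * c0 + r0) (c0 ^ 2 + r5) hE0 (by positivity)
    rintro v ⟨x, y, rfl⟩
    have := hid x y _ _ rfl rfl
    refine ⟨(2 * γ * (q * y - y0) + β * (q * x - x0)) ^ 2 - d * (q * x - x0) ^ 2, ?_⟩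
    rw [this, z2, z3, z4]
    linear_combination (q * x - x0) ^ 2 * z1
  rcases o1 with o1 | o1
  · rcases o2 with o2 | o2
    · exact thin_pos β γ d q x0 y0 E κ c0 r0 r1 r2 r3 r4 r5 F hd0 hγ hq0 hE0 hκ hid ρ hρ2 hρ0 o1
        (by linarith)
    · exact hdeg _ (Or.inr rfl) o2
  · exact hdeg _ (Or.inl rfl) o1

theorem monomial_two (m : Fin 2 →₀ ℕ) (c : ℤ) :
    (monomial m c : MvPolynomial (Fin 2) ℤ) = C c * (X 0 ^ m 0 * X 1 ^ m 1) := by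
  rw [monomial_eq, Finsupp.prod_fintype _ _ (by simp), Fin.prod_univ_two]

theorem form_one {G : MvPolynomial (Fin 2) ℤ} (hG : G.IsHomogeneous 1) :
    ∃ p q : ℤ, G = C p * X 0 + C q * X 1 := by
  rw [G.as_sum]
  apply Finset.sum_induction _ (fun G => ∃ p q : ℤ, G = C p * X 0 + C q * X 1)
  · rintro _ _ ⟨p, q, rfl⟩ ⟨p', q', rfl⟩
    exact ⟨p + p', q + q', by simp only [map_add]; ring⟩
  · exact ⟨0, 0, by simp⟩
  · intro m hm
    have h := hG.degree_eq_sum_deg_support hm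
    rw [monomial_two]
    have h2 : m 0 + m 1 = 1 := by
      have h' : m.degree = 1 := h.symm
      rw [Finsupp.degree_eq_sum] at h'
      simpa [Fin.sum_univ_two] using h'
    rcases (by omega : (m 0 = 0 ∧ m 1 = 1) ∨ (m 0 = 1 ∧ m 1 = 0)) with ⟨e, f⟩ | ⟨e, f⟩ <;> rw [e, f]
    · exact ⟨0, coeff m G, by simp⟩
    · exact ⟨coeff m G, 0, by simp⟩

theorem form_two {G : MvPolynomial (Fin 2) ℤ} (hG : G.IsHomogeneous 2) :
    ∃ p q r : ℤ, G = C p * X 0 ^ 2 + C q * (X 0 * X 1) + C r * X 1 ^ 2 := by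
  rw [G.as_sum]
  apply Finset.sum_induction _
    (fun G => ∃ p q r : ℤ, G = C p * X 0 ^ 2 + C q * (X 0 * X 1) + C r * X 1 ^ 2)
  · rintro _ _ ⟨p, q, r, rfl⟩ ⟨p', q', r', rfl⟩
    exact ⟨p + p', q + q', r + r', by simp only [map_add]; ring⟩
  · exact ⟨0, 0, 0, by simp⟩
  · intro m hm
    have h := hG.degree_eq_sum_deg_support hm
    rw [monomial_two]
    have h2 : m 0 + m 1 = 2 := by
      have h' : m.degree = 2 := h.symm
      rw [Finsupp.degree_eq_sum] at h'
      simpa [Fin.sum_univ_two] using h'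
    rcases (by omega : (m 0 = 0 ∧ m 1 = 2) ∨ (m 0 = 1 ∧ m 1 = 1) ∨ (m 0 = 2 ∧ m 1 = 0)) with
      ⟨e, f⟩ | ⟨e, f⟩ | ⟨e, f⟩ <;> rw [e, f]
    · exact ⟨0, 0, coeff m G, by simp⟩
    · exact ⟨0, coeff m G, 0, by simp⟩
    · exact ⟨coeff m G, 0, 0, by simp⟩

theorem form_zero {G : MvPolynomial (Fin 2) ℤ} (hG : G.IsHomogeneous 0) :
    ∃ p : ℤ, G = C p := by
  rw [← totalDegree_zero_iff_isHomogeneous] at hG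
  exact ⟨_, totalDegree_eq_zero_iff_eq_C.1 hG⟩

theorem psd_int {G : MvPolynomial (Fin 2) ℤ} (hG : PosSemidef2 G) (x y : ℤ) :
    0 ≤ eval ![x, y] G := by
  have h := hG x y
  have e : evalReal G x y = ((eval ![x, y] G : ℤ) : ℝ) := by
    unfold evalReal
    have := MvPolynomial.aeval_algebraMap_apply (R := ℤ) (B := ℝ) ![x, y] G
    have e2 : (algebraMap ℤ ℝ ∘ ![x, y]) = ![(x : ℝ), (y : ℝ)] := by
      funext i; fin_cases i <;> simp
    rw [e2] at this
    rw [this, aeval_eq_eval]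
    simp
  rw [e] at h
  exact_mod_cast h

theorem prim_coprime {p q : ℤ} (h : IsPrimitiveInt (C p * X 0 + C q * X 1)) :
    ∃ u v : ℤ, u * p + v * q = 1 := by
  have h1 := h (gcd p q) (by
    rw [← C_dvd_iff_dvd_coeff]
    exact dvd_add ((map_dvd C (gcd_dvd_left p q)).mul_right _)
      ((map_dvd C (gcd_dvd_right p q)).mul_right _))
  exact (gcd_isUnit_iff p q).1 h1

theorem linear_dvd {p q u v A B E : ℤ} (huv : u * p + v * q = 1)
    (h0 : A * q ^ 2 - B * (p * q) + E * p ^ 2 = 0) :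
    (C p * X 0 + C q * X 1 : MvPolynomial (Fin 2) ℤ) ∣
      C A * X 0 ^ 2 + C B * (X 0 * X 1) + C E * X 1 ^ 2 := by
  have h1 := congrArg (C : ℤ →+* MvPolynomial (Fin 2) ℤ) huv
  have h2 := congrArg (C : ℤ →+* MvPolynomial (Fin 2) ℤ) h0
  simp only [map_add, map_sub, map_mul, map_pow, map_one, map_zero] at h1 h2
  obtain ⟨S, hS⟩ : ∃ S : MvPolynomial (Fin 2) ℤ, S = C p * X 0 + C q * X 1 := ⟨_, rfl⟩
  obtain ⟨T, hT⟩ : ∃ T : MvPolynomial (Fin 2) ℤ, T = C u * X 1 - C v * X 0 := ⟨_, rfl⟩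
  have hx : (X 0 : MvPolynomial (Fin 2) ℤ) = C u * S - C q * T := by
    rw [hS, hT]; linear_combination (-X 0) * h1
  have hy : (X 1 : MvPolynomial (Fin 2) ℤ) = C v * S + C p * T := by
    rw [hS, hT]; linear_combination (-X 1) * h1
  rw [← hS, hx, hy]
  refine ⟨(C A * C u ^ 2 + C B * (C u * C v) + C E * C v ^ 2) * S
    + (-2 * C A * (C u * C q) + C B * (C u * C p - C q * C v) + 2 * C E * (C v * C p)) * T, ?_⟩
  linear_combination T ^ 2 * h2

theorem change_set (F : ℤ → ℤ → ℤ) {p q u v : ℤ} (huv : u * p + v * q = 1) :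
    {w | ∃ x y, F x y = w} = {w | ∃ s t, F (u * s - q * t) (v * s + p * t) = w} := by
  ext w
  constructor
  · rintro ⟨x, y, rfl⟩
    refine ⟨p * x + q * y, u * y - v * x, ?_⟩
    congr 1
    · linear_combination x * huv
    · linear_combination y * huv
  · rintro ⟨s, t, rfl⟩
    exact ⟨_, _, rfl⟩

theorem irr_disc {α β γ : ℤ}
    (h : Irreducible (toQ (C α * X 0 ^ 2 + C β * (X 0 * X 1) + C γ * X 1 ^ 2))) :
    ¬ IsSquare (β ^ 2 - 4 * α * γ) := by
  rintro ⟨e, he⟩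
  have key : ∀ a b c d : ℚ, toQ (C α * X 0 ^ 2 + C β * (X 0 * X 1) + C γ * X 1 ^ 2) ≠
      (C a * X 0 + C b * X 1) * (C c * X 0 + C d * X 1) := by
    intro a b c d hh
    rcases h.isUnit_or_isUnit hh with h1 | h1
    · have := h1.map (eval ![(0 : ℚ), 0])
      simp at this
    · have := h1.map (eval ![(0 : ℚ), 0])
      simp at this
  by_cases hγ : γ = 0
  · subst hγ
    apply key 1 0 α β
    simp [toQ]
    ring
  · have hγ' : (γ : ℚ) ≠ 0 := by exact_mod_cast hγ
    have heQ : (β : ℚ) ^ 2 - 4 * α * γ = e * e := by exact_mod_cast he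
    apply key ((β - e) / (4 * γ)) (1 / 2) (β + e) (2 * γ)
    have e1 : (α : ℚ) = (β - e) / (4 * γ) * (β + e) := by
      field_simp; linear_combination (-1 : ℚ) * heQ
    have e2 : (β : ℚ) = (β - e) / (4 * γ) * (2 * γ) + 1 / 2 * (β + e) := by field_simp; ring
    have e3 : (γ : ℚ) = 1 / 2 * (2 * γ) := by ring
    have h1 := congrArg (C : ℚ →+* MvPolynomial (Fin 2) ℚ) e1
    have h2 := congrArg (C : ℚ →+* MvPolynomial (Fin 2) ℚ) e2
    have h3 := congrArg (C : ℚ →+* MvPolynomial (Fin 2) ℚ) e3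
    rw [map_mul] at h1 h3
    rw [map_add, map_mul _ (((β : ℚ) - e) / (4 * γ)), map_mul _ (1 / 2 : ℚ)] at h2
    have h4 : toQ (C α * X 0 ^ 2 + C β * (X 0 * X 1) + C γ * X 1 ^ 2) =
        C (α : ℚ) * X 0 ^ 2 + C (β : ℚ) * (X 0 * X 1) + C (γ : ℚ) * X 1 ^ 2 := by simp [toQ]
    rw [h4]
    linear_combination X 0 ^ 2 * h1 + X 0 * X 1 * h2 + X 1 ^ 2 * h3

theorem indef_disc {α β γ : ℤ}
    (h : Indefinite2 (C α * X 0 ^ 2 + C β * (X 0 * X 1) + C γ * X 1 ^ 2))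
    (hsq : ¬ IsSquare (β ^ 2 - 4 * α * γ)) : 0 < β ^ 2 - 4 * α * γ := by
  have hγ : γ ≠ 0 := by
    rintro rfl
    exact hsq ⟨β, by ring⟩
  by_contra hd
  have hdR : (β : ℝ) ^ 2 - 4 * α * γ ≤ 0 := by exact_mod_cast not_lt.1 hd
  obtain ⟨⟨x, y, h1⟩, ⟨x', y', h2⟩⟩ := h
  simp [evalReal] at h1 h2
  have key : ∀ s t : ℝ, 0 ≤ γ * (α * s ^ 2 + β * (s * t) + γ * t ^ 2) := by
    intro s t
    have e : 4 * (γ * (α * s ^ 2 + β * (s * t) + γ * t ^ 2)) =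
      (2 * γ * t + β * s) ^ 2 + (-((β : ℝ) ^ 2 - 4 * α * γ)) * s ^ 2 := by ring
    have : 0 ≤ (-((β : ℝ) ^ 2 - 4 * α * γ)) * s ^ 2 := mul_nonneg (by linarith) (sq_nonneg _)
    nlinarith [sq_nonneg (2 * γ * t + β * s)]
  have k1 := key x y
  have k2 := key x' y'
  have g1 : (0 : ℝ) ≤ γ := nonneg_of_mul_nonneg_left k1 h1
  have g2 : (γ : ℝ) ≤ 0 := by
    by_contra hg
    have := mul_neg_of_pos_of_neg (not_le.1 hg) h2
    linarith
  apply hγ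
  exact_mod_cast le_antisymm g2 g1


theorem quadratically_composed_value_set_ne
    (F : MvPolynomial (Fin 2) ℤ) (hdeg : F.totalDegree = 4)
    (h0 : MvPolynomial.eval ![0, 0] F = 0) (hqc : QuadraticallyComposed F)
    (C : ℤ) (hC : 0 < C) (D : ℤ) :
    valueSet F ≠ targetSet C D := by
  intro hset
  obtain ⟨H, G4, G3, r, hr, h4, h3, hF, hpsd, hH, ⟨n4, hn4⟩, ⟨n3, hn3⟩, hd4, hd3, hd2⟩ := hqc
  have hG4 : G4 ≠ 0 := by rintro rfl; exact hd4 (dvd_zero _)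
  have hG3 : G3 ≠ 0 := by rintro rfl; exact hd3 (dvd_zero _)
  have hH0 : H ≠ 0 := by
    rintro rfl
    have hp : IsPrimitiveInt (0 : MvPolynomial (Fin 2) ℤ) := by
      rcases hH with h | h
      · exact h.2
      · exact h.2.1
    have := hp 2 (by simp)
    rw [Int.isUnit_iff] at this
    omega
  have hhom4 := homogeneousComponent_isHomogeneous 4 F
  have hhom3 := homogeneousComponent_isHomogeneous 3 F
  have hhom2 := homogeneousComponent_isHomogeneous 2 F
  have hhom1 := homogeneousComponent_isHomogeneous 1 F
  obtain ⟨F2, hF2⟩ : ∃ P, P = homogeneousComponent 2 F := ⟨_, rfl⟩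
  obtain ⟨F1, hF1⟩ : ∃ P, P = homogeneousComponent 1 F := ⟨_, rfl⟩
  rw [h4, h3, ← hF2, ← hF1] at hF
  rw [h4] at hhom4 hpsd
  rw [h3] at hhom3
  rw [← hF2] at hhom2 hd2
  rw [← hF1] at hhom1
  have hlb : ∀ x y : ℤ, D ≤ eval ![x, y] F := by
    intro x y
    have : eval ![x, y] F ∈ targetSet C D := by rw [← hset]; exact ⟨x, y, rfl⟩
    exact this.2
  have hset2 : {w | ∃ x y, (fun x y : ℤ => eval ![x, y] F) x y = w} = targetSet C D := hset
  have hdg : ∀ j, H.IsHomogeneous j → j * (2 * r) + n4 = 4 ∧ j * r + n3 = 3 := by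
    intro j hj
    exact ⟨((hj.pow (2 * r)).mul hn4).inj_right hhom4 (mul_ne_zero (pow_ne_zero _ hH0) hG4),
      ((hj.pow r).mul hn3).inj_right hhom3 (mul_ne_zero (pow_ne_zero _ hH0) hG3)⟩
  have hpsdI := psd_int hpsd
  clear hpsd hF2 hF1 h4 h3 hdeg h0 hhom4 hhom3
  obtain ⟨g, h, k, rfl⟩ := form_two hhom2
  obtain ⟨l, m, rfl⟩ := form_one hhom1
  rcases hH with ⟨hH1, hprim⟩ | ⟨hH2, hprim, hirr, hind⟩
  · obtain ⟨e4, e3⟩ := hdg 1 hH1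
    obtain ⟨p, q, rfl⟩ := form_one hH1
    obtain ⟨u, v, huv⟩ := prim_coprime hprim
    have hlin : ∀ s t : ℤ, p * (u * s - q * t) + q * (v * s + p * t) = s := by
      intro s t; linear_combination s * huv
    rw [change_set _ huv] at hset2
    rcases hr with rfl | rfl
    · obtain rfl : n4 = 2 := by omega
      obtain rfl : n3 = 2 := by omega
      obtain ⟨a, b, c, rfl⟩ := form_two hn4
      obtain ⟨d, e, f, rfl⟩ := form_two hn3
      have hc : a * q ^ 2 - b * (p * q) + c * p ^ 2 ≠ 0 := fun hz => hd4 (linear_dvd huv hz)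
      have hev : ∀ s t : ℤ, eval ![u * s - q * t, v * s + p * t] F =
          s ^ 2 * ((a * u ^ 2 + b * (u * v) + c * v ^ 2) * s ^ 2
            + (-2 * a * (u * q) + b * (u * p - q * v) + 2 * c * (v * p)) * (s * t)
            + (a * q ^ 2 - b * (p * q) + c * p ^ 2) * t ^ 2)
          + s * ((d * u ^ 2 + e * (u * v) + f * v ^ 2) * s ^ 2
            + (-2 * d * (u * q) + e * (u * p - q * v) + 2 * f * (v * p)) * (s * t)
            + (d * q ^ 2 - e * (p * q) + f * p ^ 2) * t ^ 2)
          + ((g * u ^ 2 + h * (u * v) + k * v ^ 2) * s ^ 2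
            + (-2 * g * (u * q) + h * (u * p - q * v) + 2 * k * (v * p)) * (s * t)
            + (g * q ^ 2 - h * (p * q) + k * p ^ 2) * t ^ 2)
          + ((l * u + m * v) * s + (m * p - l * q) * t) := by
        intro s t
        rw [hF]
        simp
        rw [hlin]
        ring
      apply ThinV.ne_target (C := C) (D := D) hC
      rw [← hset2]
      refine core_A _ _ _ _ _ _ _ _ _ _ _ D
        (fun s t : ℤ => eval ![u * s - q * t, v * s + p * t] F) hev (fun s t => hlb _ _) hc ?_
      intro s t
      have := hpsdI (u * s - q * t) (v * s + p * t)
      simp at this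
      rw [hlin] at this
      convert this using 1
      ring
    · obtain rfl : n4 = 0 := by omega
      obtain rfl : n3 = 1 := by omega
      obtain ⟨a, rfl⟩ := form_zero hn4
      obtain ⟨d, e, rfl⟩ := form_one hn3
      have hc : g * q ^ 2 - h * (p * q) + k * p ^ 2 ≠ 0 := fun hz => hd2 (linear_dvd huv hz)
      refine core_B a (d * u + e * v) (e * p - d * q) (g * u ^ 2 + h * (u * v) + k * v ^ 2)
        (-2 * g * (u * q) + h * (u * p - q * v) + 2 * k * (v * p)) _
        (l * u + m * v) (m * p - l * q) C D hC
        (fun s t : ℤ => eval ![u * s - q * t, v * s + p * t] F) ?_ hc hset2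
      intro s t
      change eval _ F = _
      rw [hF]
      simp
      rw [hlin]
      ring
  · obtain ⟨e4, e3⟩ := hdg 2 hH2
    obtain ⟨α, β, γ, rfl⟩ := form_two hH2
    have hsq := irr_disc hirr
    have hd0 := indef_disc hind hsq
    have hγ : γ ≠ 0 := by
      rintro rfl
      exact hsq ⟨β, by ring⟩
    rcases hr with rfl | rfl
    · obtain rfl : n4 = 0 := by omega
      obtain rfl : n3 = 1 := by omega
      obtain ⟨a, rfl⟩ := form_zero hn4
      obtain ⟨d, e, rfl⟩ := form_one hn3
      have ha0 : a ≠ 0 := by rintro rfl; exact hG4 (map_zero _)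
      have ha : 0 < a := by
        have := hpsdI 0 1
        simp at this
        have h2 : 0 < γ ^ 2 := by positivity
        exact lt_of_le_of_ne (nonneg_of_mul_nonneg_right this h2) ha0.symm
      apply ThinV.ne_target (C := C) (D := D) hC
      rw [← hset2]
      refine core_C a α β γ d e g h k l m D (fun s t : ℤ => eval ![s, t] F) ?_
        (fun s t => hlb _ _) ha hd0 hsq
      intro x y
      change eval _ F = _
      rw [hF]
      simp
      ring
    · omega
end

section
/- Let F ∈ ℤ[x,y] have total degree 4 with F(0,0) = 0, write F = F_4 + F_3 + F_2 + F_1 with F_i the homogeneous degree-i part, suppose F_4 is positive semi-definite, gcd(F̃_4, F_3, F_2) ≠ 1, and gcd(F̃_4, F_3, F_2, F_1) = 1. Then the infimum of F(x,y) over (x,y) ∈ ℤ² is −∞. -/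
open MvPolynomial

lemma aeval_smul_homog {σ R A : Type*} [CommRing R] [CommRing A] [Algebra R A]
    {G : MvPolynomial σ R} {n : ℕ} (hG : G.IsHomogeneous n) (s : A) (v : σ → A) :
    aeval (fun i => s * v i) G = s ^ n * aeval v G := by
  rw [aeval_def, aeval_def, eval₂_eq, eval₂_eq, Finset.mul_sum]
  refine Finset.sum_congr rfl fun d hd => ?_
  have h1 : d.degree = n := by
    rw [Finsupp.degree_eq_weight_one]; exact hG (mem_support_iff.mp hd)
  have h2 : ∏ i ∈ d.support, s ^ d i = s ^ n := by
    rw [Finset.prod_pow_eq_pow_sum]; congr 1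
  simp only [mul_pow, Finset.prod_mul_distrib, h2]
  ring

/-- The grading homomorphism. -/
noncomputable def gradeHom {σ R : Type*} [CommRing R] :
    MvPolynomial σ R →ₐ[R] Polynomial (MvPolynomial σ R) :=
  aeval (fun i => Polynomial.X * Polynomial.C (X i))

lemma gradeHom_homog {σ R : Type*} [CommRing R] {G : MvPolynomial σ R} {n : ℕ}
    (hG : G.IsHomogeneous n) : gradeHom G = Polynomial.C G * Polynomial.X ^ n := by
  unfold gradeHom
  rw [aeval_smul_homog hG, mul_comm]
  congr 1
  have : (aeval (fun i => Polynomial.C (X i)) : MvPolynomial σ R →ₐ[R] Polynomial (MvPolynomial σ R))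
      = (Polynomial.CAlgHom (R := R) (A := MvPolynomial σ R)) := by
    ext i; simp
  rw [this]; rfl

lemma gradeHom_coeff {σ R : Type*} [CommRing R] (G : MvPolynomial σ R) (j : ℕ) :
    (gradeHom G).coeff j = homogeneousComponent j G := by
  conv_lhs => rw [← sum_homogeneousComponent G]
  rw [map_sum, Polynomial.finsetSum_coeff]
  rw [Finset.sum_congr rfl (fun i _ => by
    rw [gradeHom_homog (homogeneousComponent_isHomogeneous i G)])]
  simp only [Polynomial.coeff_C_mul, Polynomial.coeff_X_pow, mul_ite, mul_one, mul_zero,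
    Finset.sum_ite_eq, Finset.mem_range]
  split_ifs with h
  · rfl
  · rw [homogeneousComponent_eq_zero]; omega

lemma homog_of_mul_left {σ R : Type*} [CommRing R] [IsDomain R] {f g : MvPolynomial σ R} {n : ℕ}
    (h : (f * g).IsHomogeneous n) (hne : f * g ≠ 0) : ∃ k, f.IsHomogeneous k := by
  have h1 := gradeHom_homog h
  rw [map_mul] at h1
  have hp0 : gradeHom f * gradeHom g ≠ 0 := by
    rw [h1]; exact mul_ne_zero (Polynomial.C_ne_zero.mpr hne) (pow_ne_zero _ Polynomial.X_ne_zero)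
  have hf := left_ne_zero_of_mul hp0
  have hg := right_ne_zero_of_mul hp0
  have d1 := Polynomial.natDegree_mul hf hg
  have d2 := Polynomial.natTrailingDegree_mul hf hg
  rw [h1] at d1 d2
  rw [Polynomial.natDegree_C_mul_X_pow _ _ hne] at d1
  have d3 : (Polynomial.C (f * g) * Polynomial.X ^ n).natTrailingDegree = n := by
    rw [Polynomial.C_mul_X_pow_eq_monomial, Polynomial.natTrailingDegree_monomial hne]
  rw [d3] at d2
  have e1 := Polynomial.natTrailingDegree_le_natDegree (gradeHom f)
  have e2 := Polynomial.natTrailingDegree_le_natDegree (gradeHom g)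
  have e3 : (gradeHom f).natTrailingDegree = (gradeHom f).natDegree := by omega
  refine ⟨(gradeHom f).natDegree, ?_⟩
  have : f = homogeneousComponent (gradeHom f).natDegree f := by
    conv_lhs => rw [← sum_homogeneousComponent f]
    by_cases hk : (gradeHom f).natDegree < f.totalDegree + 1
    · refine Finset.sum_eq_single_of_mem _ (Finset.mem_range.mpr hk) ?_
      intro b _ hb
      rw [← gradeHom_coeff]
      rcases lt_or_gt_of_ne hb with hb | hb
      · exact Polynomial.coeff_eq_zero_of_lt_natTrailingDegree (by omega)
      · exact Polynomial.coeff_eq_zero_of_natDegree_lt hb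
    · exfalso
      have : (gradeHom f).leadingCoeff = 0 := by
        rw [Polynomial.leadingCoeff, gradeHom_coeff, homogeneousComponent_eq_zero]; omega
      exact hf (Polynomial.leadingCoeff_eq_zero.mp this)
  have h5 := homogeneousComponent_isHomogeneous (gradeHom f).natDegree f
  rwa [← this] at h5

lemma toQ_homog {G : MvPolynomial (Fin 2) ℤ} {n : ℕ} (h : G.IsHomogeneous n) :
    (toQ G).IsHomogeneous n := h.map _

lemma toQ_inj {A B : MvPolynomial (Fin 2) ℤ} (h : toQ A = toQ B) : A = B :=
  map_injective _ (Int.cast_injective) h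

lemma toQ_mul (A B : MvPolynomial (Fin 2) ℤ) : toQ (A * B) = toQ A * toQ B := map_mul _ _ _

lemma evalReal_eq (G : MvPolynomial (Fin 2) ℤ) (x y : ℝ) :
    evalReal G x y = aeval ![x, y] (toQ G) := by
  unfold evalReal toQ
  rw [aeval_def, aeval_def, eval₂_map]
  congr 1

lemma eval_int_rat (G : MvPolynomial (Fin 2) ℤ) (x y : ℤ) :
    ((eval ![x, y] G : ℤ) : ℚ) = aeval ![(x : ℚ), (y : ℚ)] (toQ G) := by
  unfold toQ
  rw [aeval_def, eval₂_map]
  have : (Int.castRingHom ℚ).comp (eval ![x, y]) =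
      eval₂Hom ((algebraMap ℚ ℚ).comp (Int.castRingHom ℚ)) ![(x : ℚ), (y : ℚ)] := by
    ext i
    · simp
    · fin_cases i <;> simp
  exact congrArg (fun f => f G) this

lemma linear_dvd_s10 {G : MvPolynomial (Fin 2) ℚ} {n : ℕ} (hG : G.IsHomogeneous n) (a b : ℚ)
    (hab : a ≠ 0 ∨ b ≠ 0) (h : aeval ![a, b] G = 0) :
    (C b * X 0 - C a * X 1 : MvPolynomial (Fin 2) ℚ) ∣ G := by
  rw [← Ideal.mem_span_singleton, ← Ideal.Quotient.eq_zero_iff_mem]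
  set I := Ideal.span {(C b * X 0 - C a * X 1 : MvPolynomial (Fin 2) ℚ)} with hI
  have hrel : algebraMap ℚ _ b * (Ideal.Quotient.mk I (X 0)) = algebraMap ℚ _ a * Ideal.Quotient.mk I (X 1) := by
    have : Ideal.Quotient.mk I (C b * X 0 - C a * X 1) = 0 :=
      Ideal.Quotient.eq_zero_iff_mem.mpr (Ideal.mem_span_singleton_self _)
    rw [map_sub, sub_eq_zero, map_mul, map_mul] at this
    exact this
  have key : ∃ s : MvPolynomial (Fin 2) ℚ ⧸ I, ∀ i, Ideal.Quotient.mk I (X i) =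
      s * algebraMap ℚ _ (![a, b] i) := by
    rcases hab with ha | hb
    · have hinv : algebraMap ℚ (MvPolynomial (Fin 2) ℚ ⧸ I) a⁻¹ * algebraMap ℚ _ a = 1 := by
        rw [← map_mul, inv_mul_cancel₀ ha, map_one]
      refine ⟨algebraMap ℚ _ a⁻¹ * Ideal.Quotient.mk I (X 0), fun i => ?_⟩
      fin_cases i
      · simp only [Fin.zero_eta, Matrix.cons_val_zero]
        linear_combination (- Ideal.Quotient.mk I (X 0)) * hinv
      · simp only [Fin.mk_one, Matrix.cons_val_one, Matrix.cons_val_fin_one]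
        linear_combination (- Ideal.Quotient.mk I (X 1)) * hinv - algebraMap ℚ _ a⁻¹ * hrel
    · have hinv : algebraMap ℚ (MvPolynomial (Fin 2) ℚ ⧸ I) b⁻¹ * algebraMap ℚ _ b = 1 := by
        rw [← map_mul, inv_mul_cancel₀ hb, map_one]
      refine ⟨algebraMap ℚ _ b⁻¹ * Ideal.Quotient.mk I (X 1), fun i => ?_⟩
      fin_cases i
      · simp only [Fin.zero_eta, Matrix.cons_val_zero]
        linear_combination (- Ideal.Quotient.mk I (X 0)) * hinv + algebraMap ℚ _ b⁻¹ * hrel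
      · simp only [Fin.mk_one, Matrix.cons_val_one, Matrix.cons_val_fin_one]
        linear_combination (- Ideal.Quotient.mk I (X 1)) * hinv
  obtain ⟨s, hs⟩ := key
  have e1 : Ideal.Quotient.mk I G = aeval (fun i => Ideal.Quotient.mk I (X i)) G := by
    have : (Ideal.Quotient.mkₐ ℚ I) = aeval (fun i => Ideal.Quotient.mk I (X i)) := by
      ext i; simp
    rw [← this]; rfl
  rw [e1, funext hs, aeval_smul_homog hG]
  have e2 : aeval (fun i => algebraMap ℚ (MvPolynomial (Fin 2) ℚ ⧸ I) (![a, b] i)) G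
      = algebraMap ℚ _ (aeval ![a, b] G) := by
    exact aeval_algebraMap_apply (A := ℚ) (MvPolynomial (Fin 2) ℚ ⧸ I) ![a, b] G
  rw [e2, h]; simp

lemma gauss_aux (N : ℤ) (hN : N ≠ 0) : ∀ (T D G : MvPolynomial (Fin 2) ℤ), C N * T = D * G →
    ∃ D' G' : MvPolynomial (Fin 2) ℤ, T = D' * G' ∧ ∃ r : ℚ, r ≠ 0 ∧ toQ D' = C r * toQ D := by
  induction N using UniqueFactorizationMonoid.induction_on_prime with
  | h₁ => exact absurd rfl hN
  | h₂ u hu =>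
    intro T D G h
    obtain ⟨u', rfl⟩ := hu
    refine ⟨D, C (↑u'⁻¹ : ℤ) * G, ?_, 1, one_ne_zero, by simp⟩
    rw [mul_left_comm, ← h, ← mul_assoc, ← C_mul, Units.inv_mul]; simp
  | h₃ a p ha hp ih =>
    intro T D G h
    have hpC : Prime (C p : MvPolynomial (Fin 2) ℤ) := (prime_C_iff _).mpr hp
    have hd : (C p : MvPolynomial (Fin 2) ℤ) ∣ D * G := by
      rw [← h, C_mul, mul_assoc]; exact dvd_mul_right _ _
    rcases hpC.dvd_or_dvd hd with ⟨D1, rfl⟩ | ⟨G1, rfl⟩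
    · have : C a * T = D1 * G := mul_left_cancel₀ hpC.ne_zero (by rw [← mul_assoc, ← C_mul, h]; ring)
      obtain ⟨D', G', h1, r, hr, h2⟩ := ih ha T D1 G this
      have hpq : (p : ℚ) ≠ 0 := by exact_mod_cast hp.ne_zero
      refine ⟨D', G', h1, r / p, div_ne_zero hr hpq, ?_⟩
      rw [h2, toQ_mul]
      have : toQ (C p) = C (p : ℚ) := by simp [toQ]
      rw [this, ← mul_assoc, ← C_mul, div_mul_cancel₀ _ hpq]
    · have : C a * T = D * G1 := mul_left_cancel₀ hpC.ne_zero (by rw [← mul_assoc, ← C_mul, h]; ring)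
      exact ih ha T D G1 this

lemma clear_denom (d : MvPolynomial (Fin 2) ℚ) :
    ∃ (N : ℤ) (D : MvPolynomial (Fin 2) ℤ), N ≠ 0 ∧ toQ D = C (N : ℚ) * d := by
  induction d using MvPolynomial.induction_on with
  | C a =>
    refine ⟨a.den, C a.num, by exact_mod_cast a.den_ne_zero, ?_⟩
    rw [← C_mul]; simp [toQ, Rat.den_mul_eq_num]
  | add p q hp hq =>
    obtain ⟨N, D, hN, h⟩ := hp
    obtain ⟨N', D', hN', h'⟩ := hq
    refine ⟨N * N', C N' * D + C N * D', mul_ne_zero hN hN', ?_⟩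
    have : toQ (C N' * D + C N * D') = C (N' : ℚ) * toQ D + C (N : ℚ) * toQ D' := by simp [toQ]
    rw [this, h, h']; push_cast; rw [C_mul]; ring
  | mul_X p i hp =>
    obtain ⟨N, D, hN, h⟩ := hp
    refine ⟨N, D * X i, hN, ?_⟩
    rw [toQ_mul, h]; simp [toQ, mul_assoc]

lemma gauss (T : MvPolynomial (Fin 2) ℤ) (d : MvPolynomial (Fin 2) ℚ) (h : d ∣ toQ T) :
    ∃ D' G' : MvPolynomial (Fin 2) ℤ, T = D' * G' ∧ ∃ r : ℚ, r ≠ 0 ∧ toQ D' = C r * d := by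
  obtain ⟨g, hg⟩ := h
  obtain ⟨N, D, hN, hD⟩ := clear_denom d
  obtain ⟨M, G, hM, hG⟩ := clear_denom g
  have : C (N * M) * T = D * G := by
    apply toQ_inj
    rw [toQ_mul, toQ_mul, hD, hG, hg]
    simp [toQ]; ring
  obtain ⟨D', G', h1, r, hr, h2⟩ := gauss_aux (N * M) (mul_ne_zero hN hM) T D G this
  refine ⟨D', G', h1, r * N, mul_ne_zero hr (by exact_mod_cast hN), ?_⟩
  rw [h2, hD, ← mul_assoc, ← C_mul]

lemma pell_case (b c e l1 l0 e2 g1 g0 : ℚ) (hD : 0 < b ^ 2 - 4 * c)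
    (hsq : ∀ r : ℚ, r ^ 2 ≠ b ^ 2 - 4 * c) (hg : g1 ≠ 0 ∨ g0 ≠ 0) (val : ℤ → ℤ → ℚ)
    (hval : ∀ x y : ℤ, y ≠ 0 → val x y = e * ((x : ℚ) ^ 2 + b * x * y + c * y ^ 2) ^ 2 +
      (l1 * x + l0 * y) * ((x : ℚ) ^ 2 + b * x * y + c * y ^ 2) +
      e2 * ((x : ℚ) ^ 2 + b * x * y + c * y ^ 2) + (g1 * x + g0 * y)) (M : ℚ) :
    ∃ x y : ℤ, val x y < -M := by
  have ht : ∃ t : ℤ, 0 < t ∧ (l1 * t ^ 2 + g1 ≠ 0 ∨ l0 * t ^ 2 + g0 ≠ 0) := by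
    by_contra! hcon
    have h1 := hcon 1 (by norm_num)
    have h2 := hcon 2 (by norm_num)
    push_cast at h1 h2
    rcases hg with hg | hg
    · apply hg; linarith [h1.1, h2.1]
    · apply hg; linarith [h1.2, h2.2]
  obtain ⟨t, ht0, ht⟩ := ht
  have htq : (0 : ℚ) < t := by exact_mod_cast ht0
  set α := l1 * t ^ 2 + g1 with hα
  set β := l0 * t ^ 2 + g0 with hβ
  have hN : ∃ N B Δ : ℤ, N ≠ 0 ∧ (B : ℚ) = b * N ∧ (Δ : ℚ) = (b ^ 2 - 4 * c) * N ^ 2 := by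
    refine ⟨b.den * c.den, b.num * c.den, (b.num * c.den) ^ 2 - 4 * c.num * c.den * b.den ^ 2, ?_, ?_, ?_⟩
    · exact mul_ne_zero (by exact_mod_cast b.den_ne_zero) (by exact_mod_cast c.den_ne_zero)
    · push_cast
      linear_combination (-(c.den : ℚ)) * Rat.mul_den_eq_num b
    · push_cast
      rw [← Rat.mul_den_eq_num b, ← Rat.mul_den_eq_num c]
      simp only [Rat.mul_den_eq_num]
      rw [← Rat.mul_den_eq_num b, ← Rat.mul_den_eq_num c]
      ring
  obtain ⟨N, B, Δ, hN, hB, hΔ⟩ := hN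
  have hNq : (N : ℚ) ≠ 0 := by exact_mod_cast hN
  set γ := (2 * β - α * b) * N with hγ
  have hμ : 0 < |α| + |γ| := by
    by_cases ha : α = 0
    · have : γ ≠ 0 := by
        rw [hγ, ha]
        have hb : β ≠ 0 := by
          rcases ht with h | h
          · exact absurd ha h
          · exact h
        simp [hb, hN]
      positivity
    · positivity
  obtain ⟨K, hK⟩ := exists_nat_gt (max 1 ((e * t ^ 4 + e2 * t ^ 2 + M) / (t * (|α| + |γ|))))
  have hK1 : (1 : ℚ) < K := lt_of_le_of_lt (le_max_left _ _) hK
  have hK2 : e * t ^ 4 + e2 * t ^ 2 + M < K * (t * (|α| + |γ|)) :=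
    (div_lt_iff₀ (by positivity)).mp (lt_of_le_of_lt (le_max_right _ _) hK)
  have hΔpos : 0 < Δ := by
    have : (0 : ℚ) < Δ := by rw [hΔ]; positivity
    exact_mod_cast this
  have hK0 : (0 : ℤ) < K := by
    have : (0 : ℚ) < K := by linarith
    exact_mod_cast this
  have hns : ¬ IsSquare (Δ * (K : ℤ) ^ 2) := by
    rintro ⟨r, hr⟩
    have hr' : (Δ : ℚ) * (K : ℚ) ^ 2 = r * r := by exact_mod_cast hr
    apply hsq (r / (N * K))
    have : (K : ℚ) ≠ 0 := by positivity
    field_simp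
    rw [hΔ] at hr'
    linear_combination -hr'
  obtain ⟨u, w, huw, hw⟩ := Pell.exists_of_not_isSquare (by positivity) hns
  have hvK : (K : ℤ) ≤ |K * w| := by
    rw [abs_mul, abs_of_pos hK0]
    have := Int.one_le_abs hw
    nlinarith
  have huK : (K : ℤ) ≤ |u| := by
    apply le_trans hvK
    apply sq_le_sq.mp
    nlinarith [sq_nonneg (K * w : ℤ)]
  have hsgn : ∀ (a : ℚ) (z : ℤ), (K : ℤ) ≤ |z| → ∃ z' : ℤ, z' ^ 2 = z ^ 2 ∧ a * z' ≤ -(|a| * K) := by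
    intro a z hz
    have hz' : (K : ℚ) ≤ |(z : ℚ)| := by exact_mod_cast hz
    rcases le_total 0 a with ha | ha
    · refine ⟨-|z|, by simp, ?_⟩
      push_cast
      rw [abs_of_nonneg ha]; nlinarith
    · refine ⟨|z|, by simp, ?_⟩
      push_cast
      rw [abs_of_nonpos ha]; nlinarith
  obtain ⟨u', hu2, hu'⟩ := hsgn α u huK
  obtain ⟨v', hv2, hv'⟩ := hsgn γ (K * w) hvK
  have hv0 : v' ≠ 0 := by
    intro h
    rw [h] at hv2
    have : (K * w : ℤ) ≠ 0 := mul_ne_zero hK0.ne' hw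
    have := sq_pos_of_ne_zero this
    rw [← hv2] at this
    simp at this
  refine ⟨t * (u' - B * v'), 2 * t * N * v', ?_⟩
  rw [hval _ _ (by positivity)]
  have hpell : (u' : ℚ) ^ 2 - (b ^ 2 - 4 * c) * N ^ 2 * v' ^ 2 = 1 := by
    rw [← hΔ]
    have : u' ^ 2 - Δ * v' ^ 2 = 1 := by rw [hu2, hv2]; linear_combination huw
    exact_mod_cast this
  have hn : ((t * (u' - B * v') : ℤ) : ℚ) ^ 2 + b * (t * (u' - B * v') : ℤ) * (2 * t * N * v' : ℤ)
      + c * ((2 * t * N * v' : ℤ) : ℚ) ^ 2 = t ^ 2 := by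
    push_cast
    rw [hB]
    linear_combination (t : ℚ) ^ 2 * hpell
  rw [hn]
  push_cast
  rw [hB]
  have : e * ((t : ℚ) ^ 2) ^ 2 + (l1 * (t * (u' - b * N * v')) + l0 * (2 * t * N * v')) * t ^ 2 +
      e2 * t ^ 2 + (g1 * (t * (u' - b * N * v')) + g0 * (2 * t * N * v'))
      = e * t ^ 4 + e2 * t ^ 2 + t * (α * u' + γ * v') := by
    rw [hγ, hα, hβ]; ring
  rw [this]
  have h3 : t * (α * u' + γ * v') ≤ t * (-(|α| * K) + -(|γ| * K)) :=
    mul_le_mul_of_nonneg_left (add_le_add hu' hv') htq.le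
  nlinarith

/-- Dehomogenization. -/
noncomputable def deh (G : MvPolynomial (Fin 2) ℚ) : Polynomial ℚ := aeval ![Polynomial.X, 1] G

lemma deh_aeval {K : Type*} [Field K] [Algebra ℚ K] (G : MvPolynomial (Fin 2) ℚ) (s : K) :
    Polynomial.aeval s (deh G) = aeval ![s, 1] G := by
  unfold deh
  have : (Polynomial.aeval s).comp (aeval ![Polynomial.X, 1] : MvPolynomial (Fin 2) ℚ →ₐ[ℚ] Polynomial ℚ)
    = aeval ![s, 1] := by
    ext i
    fin_cases i <;> simp
  rw [← this]; rfl

lemma aeval_smul2 {K : Type*} [Field K] [Algebra ℚ K] {G : MvPolynomial (Fin 2) ℚ} {n : ℕ}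
    (hG : G.IsHomogeneous n) (t x y : K) :
    aeval ![t * x, t * y] G = t ^ n * aeval ![x, y] G := by
  rw [← aeval_smul_homog hG]
  congr 2
  ext i; fin_cases i <;> simp

lemma deh_homog {K : Type*} [Field K] [Algebra ℚ K] {G : MvPolynomial (Fin 2) ℚ} {n : ℕ}
    (hG : G.IsHomogeneous n) (x y : K) (hy : y ≠ 0) :
    aeval ![x, y] G = y ^ n * Polynomial.aeval (x / y) (deh G) := by
  rw [deh_aeval, ← aeval_smul2 hG, mul_one, mul_div_cancel₀ _ hy]

lemma deh_natDegree {G : MvPolynomial (Fin 2) ℚ} {n : ℕ} (hG : G.IsHomogeneous n) :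
    (deh G).natDegree ≤ n := by
  have := MvPolynomial.aeval_natDegree_le (n := 1) G hG.totalDegree_le ![Polynomial.X, 1] (by
    intro i; fin_cases i <;> simp)
  simpa [deh] using this

lemma deh_ne_zero {G : MvPolynomial (Fin 2) ℚ} {n : ℕ} (hG : G.IsHomogeneous n) (h : G ≠ 0) :
    deh G ≠ 0 := by
  intro h0
  have : X 1 * G = 0 := by
    apply MvPolynomial.funext
    intro v
    rw [map_mul, eval_X, map_zero]
    by_cases hv : v 1 = 0
    · rw [hv, zero_mul]
    · have := deh_homog hG (v 0) (v 1) hv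
      rw [h0, map_zero, mul_zero] at this
      have hvv : ![v 0, v 1] = v := by ext i; fin_cases i <;> rfl
      rw [hvv] at this
      have h2 : eval v G = 0 := by rw [← this, aeval_eq_eval]
      rw [h2, mul_zero]
  rcases mul_eq_zero.mp this with h1 | h1
  · exact X_ne_zero _ h1
  · exact h h1

lemma min_sq_dvd (f : Polynomial ℚ) (hf : f ≠ 0) (α : ℝ) (h0 : Polynomial.aeval α f = 0)
    (hpos : ∀ s : ℝ, 0 ≤ Polynomial.aeval s f) :
    ∃ h, f = minpoly ℚ α * minpoly ℚ α * h := by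
  have hint : IsIntegral ℚ α := IsAlgebraic.isIntegral ⟨f, hf, h0⟩
  obtain ⟨g, hg⟩ := minpoly.dvd ℚ α h0
  have hder : Polynomial.aeval α (Polynomial.derivative f) = 0 := by
    refine IsLocalMin.hasDerivAt_eq_zero (f := fun s => Polynomial.aeval s f) (a := α) ?_ (f.hasDerivAt_aeval α)
    refine Filter.Eventually.of_forall fun s => ?_
    simp only [h0]; exact hpos s
  rw [hg, Polynomial.derivative_mul, map_add, map_mul, map_mul, minpoly.aeval, zero_mul, add_zero] at hder
  have hsep := ((minpoly.irreducible hint).separable).aeval_derivative_ne_zero (minpoly.aeval ℚ α)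
  have hg0 := (mul_eq_zero.mp hder).resolve_left hsep
  obtain ⟨h, hh⟩ := minpoly.dvd ℚ α hg0
  exact ⟨h, by rw [hg]; conv_lhs => rw [hh]
               ring⟩

lemma aeval_deg_one {K : Type*} [Field K] [Algebra ℚ K] (p : Polynomial ℚ) (h : p.natDegree ≤ 1) (s : K) :
    Polynomial.aeval s p = algebraMap ℚ K (p.coeff 1) * s + algebraMap ℚ K (p.coeff 0) := by
  rw [Polynomial.aeval_eq_sum_range' (n := 2) (by omega)]
  simp [Finset.sum_range_succ, Algebra.smul_def]; ring

lemma aeval_deg_two {K : Type*} [Field K] [Algebra ℚ K] (p : Polynomial ℚ) (hm : p.Monic) (h : p.natDegree = 2) (s : K) :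
    Polynomial.aeval s p = s ^ 2 + algebraMap ℚ K (p.coeff 1) * s + algebraMap ℚ K (p.coeff 0) := by
  rw [Polynomial.aeval_eq_sum_range' (n := 3) (by omega)]
  have : p.coeff 2 = 1 := by rw [← h]; exact hm
  simp [Finset.sum_range_succ, Algebra.smul_def, this]; ring

lemma no_zero_sign (d : MvPolynomial (Fin 2) ℤ)
    (h : ∀ x y : ℝ, (x, y) ≠ (0, 0) → evalReal d x y ≠ 0) : PosDef2 d ∨ PosDef2 (-d) := by
  have hc : Continuous (fun p : ℝ × ℝ => evalReal d p.1 p.2) := by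
    have : (fun p : ℝ × ℝ => evalReal d p.1 p.2) =
        fun p => eval₂ (algebraMap ℤ ℝ) ![p.1, p.2] d := by
      ext p; rw [evalReal, aeval_def]
    rw [this]
    simp only [eval₂_eq]
    refine continuous_finsetSum _ fun m _ => continuous_const.mul
      (continuous_finsetProd _ fun i _ => Continuous.pow ?_ _)
    fin_cases i
    · exact continuous_fst
    · exact continuous_snd
  have hpre : IsPreconnected ({(0 : ℝ × ℝ)}ᶜ) :=
    (isConnected_compl_singleton_of_one_lt_rank (by
      rw [rank_prod']; simp [Module.rank_self]; norm_num) 0).isPreconnected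
  by_contra! hcon
  obtain ⟨h1, h2⟩ := hcon
  unfold PosDef2 at h1 h2
  push Not at h1 h2
  obtain ⟨x1, y1, n1, h1⟩ := h1
  obtain ⟨x2, y2, n2, h2⟩ := h2
  have h2' : 0 ≤ evalReal d x2 y2 := by
    unfold evalReal at h2 ⊢
    rw [map_neg] at h2; linarith
  obtain ⟨p, hp, hp0⟩ := hpre.intermediate_value (a := (x1, y1)) (b := (x2, y2)) n1 n2 hc.continuousOn
    (show (0 : ℝ) ∈ Set.Icc _ _ from ⟨h1, h2'⟩)
  exact h p.1 p.2 hp hp0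
/-- **Lemma 2.7.** Suppose `F ∈ ℤ[x,y]` has degree 4, `F(0,0) = 0`, the
degree-4 part `F₄` is positive semi-definite, `gcd(F̃₄, F₃, F₂) ≠ 1` and
`gcd(F̃₄, F₃, F₂, F₁) = 1`.  Then `inf_{(x,y) ∈ ℤ²} F(x,y) = -∞`. -/
theorem gcd_three_not_four_inf_neg_infty
    (F : MvPolynomial (Fin 2) ℤ) (hdeg : F.totalDegree = 4)
    (h0 : MvPolynomial.eval ![0, 0] F = 0)
    (hpsd : PosSemidef2 (MvPolynomial.homogeneousComponent 4 F))
    (Ft4 : MvPolynomial (Fin 2) ℤ)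
    (htilde : IsTildePart (MvPolynomial.homogeneousComponent 4 F) Ft4)
    (hgcd3 : CommonFactor3 Ft4 (MvPolynomial.homogeneousComponent 3 F)
      (MvPolynomial.homogeneousComponent 2 F))
    (hgcd4 : ¬ CommonFactor4 Ft4 (MvPolynomial.homogeneousComponent 3 F)
      (MvPolynomial.homogeneousComponent 2 F) (MvPolynomial.homogeneousComponent 1 F)) :
    ∀ M : ℤ, ∃ x y : ℤ, MvPolynomial.eval ![x, y] F < -M := by
  intro M
  set F4 := homogeneousComponent 4 F with hF4
  set F3 := homogeneousComponent 3 F with hF3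
  set F2 := homogeneousComponent 2 F with hF2
  set F1 := homogeneousComponent 1 F with hF1
  have q4 : (toQ F4).IsHomogeneous 4 := toQ_homog (homogeneousComponent_isHomogeneous _ _)
  have q3 : (toQ F3).IsHomogeneous 3 := toQ_homog (homogeneousComponent_isHomogeneous _ _)
  have q2 : (toQ F2).IsHomogeneous 2 := toQ_homog (homogeneousComponent_isHomogeneous _ _)
  have q1 : (toQ F1).IsHomogeneous 1 := toQ_homog (homogeneousComponent_isHomogeneous _ _)
  have hF : toQ F = toQ F4 + toQ F3 + toQ F2 + toQ F1 := by
    have hz : homogeneousComponent 0 F = 0 := by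
      rw [homogeneousComponent_zero]
      have : ![(0 : ℤ), 0] = 0 := by ext i; fin_cases i <;> rfl
      rw [this, eval_zero, constantCoeff_eq] at h0
      rw [h0, C_0]
    have hs := sum_homogeneousComponent F
    rw [hdeg] at hs
    simp only [Finset.sum_range_succ, Finset.sum_range_zero, hz, zero_add] at hs
    rw [← hF4, ← hF3, ← hF2, ← hF1] at hs
    conv_lhs => rw [← hs]
    simp only [toQ, map_add]
    ring
  obtain ⟨P0, k, hP0, hP0d, hmul, ⟨n, hFt⟩, hprim, hmax⟩ := htilde
  have hFt0 : Ft4 ≠ 0 := by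
    rintro rfl
    exact absurd (hprim 0 (by simp)) (by simp)
  have hFtQ0 : toQ Ft4 ≠ 0 := fun h => hFt0 (toQ_inj (h.trans (by simp [toQ])))
  have hP00 : P0 ≠ 0 := by
    rintro rfl
    have := hP0d 1 0 (by simp)
    simp [evalReal] at this
  have qt : (toQ Ft4).IsHomogeneous n := toQ_homog hFt
  have hmulQ : toQ F4 = toQ P0 * toQ Ft4 := by rw [hmul, toQ_mul]
  have hF40 : toQ F4 ≠ 0 := by
    rw [hmulQ]
    exact mul_ne_zero (fun h => hP00 (toQ_inj (h.trans (by simp [toQ])))) hFtQ0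
  -- rational root case
  have linear_case : ∀ a b : ℤ, (a ≠ 0 ∨ b ≠ 0) → aeval ![(a : ℚ), (b : ℚ)] (toQ Ft4) = 0 →
      aeval ![(a : ℚ), (b : ℚ)] (toQ F3) = 0 → aeval ![(a : ℚ), (b : ℚ)] (toQ F2) = 0 →
      ∃ x y : ℤ, MvPolynomial.eval ![x, y] F < -M := by
    intro a b hab ht h3 h2
    have habq : (a : ℚ) ≠ 0 ∨ (b : ℚ) ≠ 0 := by exact_mod_cast hab
    have h4 : aeval ![(a : ℚ), (b : ℚ)] (toQ F4) = 0 := by rw [hmulQ, map_mul, ht, mul_zero]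
    have h1 : aeval ![(a : ℚ), (b : ℚ)] (toQ F1) ≠ 0 := by
      intro h1
      apply hgcd4
      refine ⟨C (b : ℚ) * X 0 - C (a : ℚ) * X 1, ?_, linear_dvd_s10 qt _ _ habq ht,
        linear_dvd_s10 q3 _ _ habq h3, linear_dvd_s10 q2 _ _ habq h2, linear_dvd_s10 q1 _ _ habq h1⟩
      have hl : (C (b : ℚ) * X 0 - C (a : ℚ) * X 1 : MvPolynomial (Fin 2) ℚ).IsHomogeneous 1 :=
        ((isHomogeneous_X _ _).C_mul _).sub ((isHomogeneous_X _ _).C_mul _)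
      rw [hl.totalDegree]
      · exact one_pos
      · intro h
        have e0 := congrArg (eval ![(1 : ℚ), 0]) h
        have e1 := congrArg (eval ![(0 : ℚ), 1]) h
        simp at e0 e1
        rcases hab with h | h
        · exact h e1
        · exact h e0
    have hint := eval_int_rat F1 a b
    set w := eval ![a, b] F1 with hw
    have hw0 : w ≠ 0 := by
      intro h
      rw [h] at hint
      exact h1 (by rw [← hint]; simp)
    have hgen : ∀ t : ℤ, eval ![t * a, t * b] F = t * w := by
      intro t
      have : ((eval ![t * a, t * b] F : ℤ) : ℚ) = t * w := by
        rw [eval_int_rat, hF]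
        push_cast
        rw [map_add, map_add, map_add, aeval_smul2 q4, aeval_smul2 q3, aeval_smul2 q2,
          aeval_smul2 q1, h4, h3, h2, hint]
        ring
      exact_mod_cast this
    refine ⟨-w * (|M| + 1) * a, -w * (|M| + 1) * b, ?_⟩
    rw [hgen]
    have hw2 : 1 ≤ w ^ 2 := by
      have := sq_pos_of_ne_zero hw0
      omega
    nlinarith [abs_nonneg M, le_abs_self M]
  obtain ⟨d, hd, hdt, hd3, hd2⟩ := hgcd3
  by_cases hroot : ∃ x y : ℝ, (x, y) ≠ (0, 0) ∧ aeval ![x, y] d = 0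
  · obtain ⟨x, y, hxy, hzero⟩ := hroot
    have van : ∀ G : MvPolynomial (Fin 2) ℚ, d ∣ G → aeval ![x, y] G = 0 := by
      rintro G ⟨g, rfl⟩
      rw [map_mul, hzero, zero_mul]
    by_cases hy : y = 0
    · subst hy
      have hx : x ≠ 0 := by
        rintro rfl
        exact hxy rfl
      have van' : ∀ (G : MvPolynomial (Fin 2) ℚ) (j : ℕ), G.IsHomogeneous j → d ∣ G →
          aeval ![((1 : ℤ) : ℚ), ((0 : ℤ) : ℚ)] G = 0 := by
        intro G j hG hdG
        have h1 := van G hdG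
        have h2 := aeval_smul2 hG x 1 0
        rw [mul_one, mul_zero, h1] at h2
        have h3 := (mul_eq_zero.mp h2.symm).resolve_left (pow_ne_zero _ hx)
        have h4 := aeval_algebraMap_apply (A := ℚ) ℝ ![((1 : ℤ) : ℚ), ((0 : ℤ) : ℚ)] G
        have h5 : (algebraMap ℚ ℝ) ∘ ![((1 : ℤ) : ℚ), ((0 : ℤ) : ℚ)] = ![1, 0] := by
          ext i; fin_cases i <;> simp
        rw [h5, h3] at h4
        exact (map_eq_zero _).mp h4.symm
      exact linear_case 1 0 (by simp) (van' _ _ qt hdt) (van' _ _ q3 hd3) (van' _ _ q2 hd2)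
    · set α := x / y with hα
      have van' : ∀ (G : MvPolynomial (Fin 2) ℚ) (j : ℕ), G.IsHomogeneous j → d ∣ G →
          Polynomial.aeval α (deh G) = 0 := by
        intro G j hG hdG
        have h1 := van G hdG
        rw [deh_homog hG x y hy] at h1
        exact (mul_eq_zero.mp h1).resolve_left (pow_ne_zero _ hy)
      have rt := van' _ _ qt hdt
      have r3 := van' _ _ q3 hd3
      have r2 := van' _ _ q2 hd2
      have r4 := van' _ _ q4 (hmulQ ▸ hdt.mul_left _)
      have f40 := deh_ne_zero q4 hF40
      have hint : IsIntegral ℚ α := IsAlgebraic.isIntegral ⟨_, f40, r4⟩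
      obtain ⟨h, hh⟩ := min_sq_dvd (deh (toQ F4)) f40 α r4 (by
        intro s
        rw [deh_aeval, ← evalReal_eq]
        exact hpsd s 1)
      have hm0 := minpoly.ne_zero hint
      have hmon := minpoly.monic hint
      set m := minpoly ℚ α with hm
      have hh0 : h ≠ 0 := by
        rintro rfl
        exact f40 (by rw [hh, mul_zero])
      have deg4 := deh_natDegree q4
      rw [hh, Polynomial.natDegree_mul (mul_ne_zero hm0 hm0) hh0, Polynomial.natDegree_mul hm0 hm0] at deg4
      have hmpos : 0 < m.natDegree := minpoly.natDegree_pos hint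
      by_cases hm1 : m.natDegree = 1
      · rw [hm, minpoly.natDegree_eq_one_iff] at hm1
        obtain ⟨r, hr⟩ := hm1
        have van'' : ∀ (G : MvPolynomial (Fin 2) ℚ) (j : ℕ), G.IsHomogeneous j →
            Polynomial.aeval α (deh G) = 0 → aeval ![(r.num : ℚ), ((r.den : ℤ) : ℚ)] G = 0 := by
          intro G j hG hdG
          have hden : ((r.den : ℤ) : ℚ) ≠ 0 := by
            exact_mod_cast r.den_ne_zero
          rw [deh_homog hG _ _ hden]
          have : (r.num : ℚ) / ((r.den : ℤ) : ℚ) = r := by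
            push_cast; exact Rat.num_div_den r
          rw [this]
          rw [← hr, Polynomial.aeval_algebraMap_apply] at hdG
          rw [(map_eq_zero _).mp hdG, mul_zero]
        exact linear_case r.num r.den (Or.inr (by exact_mod_cast r.den_ne_zero))
          (van'' _ _ qt rt) (van'' _ _ q3 r3) (van'' _ _ q2 r2)
      · have hm2 : m.natDegree = 2 := by omega
        have hhc : h.natDegree = 0 := by omega
        obtain ⟨e3, he3⟩ := minpoly.dvd ℚ α r3
        obtain ⟨e2, he2⟩ := minpoly.dvd ℚ α r2
        rw [← hm] at he3 he2
        have de3 : e3.natDegree ≤ 1 := by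
          by_cases hz : e3 = 0
          · simp [hz]
          · have := deh_natDegree q3
            rw [he3, Polynomial.natDegree_mul hm0 hz] at this
            omega
        have de2 : e2.natDegree ≤ 0 := by
          by_cases hz : e2 = 0
          · simp [hz]
          · have := deh_natDegree q2
            rw [he2, Polynomial.natDegree_mul hm0 hz] at this
            omega
        have de1 := deh_natDegree q1
        set b := m.coeff 1 with hb
        set c := m.coeff 0 with hc
        have hroot : α ^ 2 + (b : ℝ) * α + (c : ℝ) = 0 := by
          have := aeval_deg_two m hmon hm2 α
          rw [hm, minpoly.aeval, ← hm] at this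
          exact this.symm
        have hsqR : (2 * α + b) ^ 2 = ((b ^ 2 - 4 * c : ℚ) : ℝ) := by
          push_cast
          linear_combination 4 * hroot
        have hsq : ∀ r : ℚ, r ^ 2 ≠ b ^ 2 - 4 * c := by
          intro r hr
          apply hm1
          rw [hm, minpoly.natDegree_eq_one_iff]
          rw [← hr] at hsqR
          push_cast at hsqR
          rcases sq_eq_sq_iff_eq_or_eq_neg.mp hsqR with h | h
          · refine ⟨(r - b) / 2, ?_⟩
            rw [eq_ratCast]; push_cast; linarith
          · refine ⟨(-r - b) / 2, ?_⟩
            rw [eq_ratCast]; push_cast; linarith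
        have hDpos : 0 < b ^ 2 - 4 * c := by
          have h1 : (0 : ℝ) ≤ ((b ^ 2 - 4 * c : ℚ) : ℝ) := by rw [← hsqR]; positivity
          have h2 : 0 ≤ b ^ 2 - 4 * c := by exact_mod_cast h1
          refine lt_of_le_of_ne h2 ?_
          have := hsq 0
          simpa using this
        have hg : (deh (toQ F1)).coeff 1 ≠ 0 ∨ (deh (toQ F1)).coeff 0 ≠ 0 := by
          by_contra! hcon
          have hz : toQ F1 = 0 := by
            by_contra hne
            apply deh_ne_zero q1 hne
            rw [Polynomial.eq_X_add_C_of_natDegree_le_one de1, hcon.1, hcon.2]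
            simp
          exact hgcd4 ⟨d, hd, hdt, hd3, hd2, hz ▸ dvd_zero d⟩
        obtain ⟨x', y', hlt⟩ := pell_case b c (h.coeff 0) (e3.coeff 1) (e3.coeff 0) (e2.coeff 0)
          ((deh (toQ F1)).coeff 1) ((deh (toQ F1)).coeff 0) hDpos hsq hg
          (fun x y => ((eval ![x, y] F : ℤ) : ℚ)) (by
            intro x y hy
            have hyq : (y : ℚ) ≠ 0 := by exact_mod_cast hy
            rw [eval_int_rat, hF, map_add, map_add, map_add, deh_homog q4 _ _ hyq,
              deh_homog q3 _ _ hyq, deh_homog q2 _ _ hyq, deh_homog q1 _ _ hyq, hh, he3, he2,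
              map_mul, map_mul, map_mul, map_mul, aeval_deg_two m hmon hm2,
              aeval_deg_one h (by omega), aeval_deg_one e3 de3, aeval_deg_one e2 (by omega),
              aeval_deg_one _ de1, Polynomial.coeff_eq_zero_of_natDegree_lt (p := h) (n := 1) (by omega),
              Polynomial.coeff_eq_zero_of_natDegree_lt (p := e2) (n := 1) (by omega)]
            simp only [eq_ratCast, Rat.cast_id, ← hb, ← hc]
            field_simp
            ring) (M : ℚ)
        exact ⟨x', y', by exact_mod_cast hlt⟩
  · exfalso
    push Not at hroot
    obtain ⟨D, G, hDG, r, hr, hDr⟩ := gauss Ft4 d hdt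
    have hdh : ∃ j, d.IsHomogeneous j := by
      obtain ⟨g, hg⟩ := hdt
      rw [hg] at qt hFtQ0
      exact homog_of_mul_left qt hFtQ0
    obtain ⟨j, hj⟩ := hdh
    have hd0 : d ≠ 0 := by
      rintro rfl
      simp at hd
    have hjpos : 0 < j := by rwa [hj.totalDegree hd0] at hd
    have hDj : D.IsHomogeneous j := by
      have h1 : (toQ D).IsHomogeneous j := by rw [hDr]; exact hj.C_mul r
      intro m hm
      apply h1
      rw [toQ, coeff_map]
      simpa using hm
    have hnz : ∀ x y : ℝ, (x, y) ≠ (0, 0) → evalReal D x y ≠ 0 := by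
      intro x y hxy
      rw [evalReal_eq, hDr, map_mul, aeval_C]
      refine mul_ne_zero ?_ (hroot x y hxy)
      rw [eq_ratCast]
      exact_mod_cast hr
    have key : ∀ D G : MvPolynomial (Fin 2) ℤ, Ft4 = D * G → D.IsHomogeneous j → PosDef2 D → False := by
      intro D G hDG hDj hpos
      have := hmax (P0 * D) G (k + j) (hP0.mul hDj) (by
        intro x y hxy
        have h1 := hP0d x y hxy
        have h2 := hpos x y hxy
        unfold evalReal at h1 h2 ⊢
        rw [map_mul]
        positivity) (by rw [hmul, hDG, mul_assoc]) (by
          rw [hDG, mul_comm] at hFt hFt0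
          exact homog_of_mul_left hFt hFt0) (by
          intro z hz
          apply hprim
          rw [← C_dvd_iff_dvd_coeff] at hz ⊢
          rw [hDG]
          exact hz.mul_left _)
      omega
    rcases no_zero_sign D hnz with h | h
    · exact key D G hDG hDj h
    · exact key (-D) (-G) (by rw [hDG]; ring) hDj.neg h
end
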